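/- Let m ≥ 1 be an integer and let q be a power of 2. Then the maximum order of an element of the finite symplectic group Sp_{2m}(q) equals M_m(q); that is, Sp_{2m}(q) contains an element of order M_m(q), and every element of Sp_{2m}(q) has order at most M_m(q). -/

import Mathlib

/-- `Mm m q` is the function `M_m(q)` from Definition 1.2 of the paper. -/
def Mm (m q : ℕ) : ℕ :=
  if q = 2 then
    -- `L` is the largest positive integer `ℓ` with `2^ℓ - 1 ≤ m`
    let L := Nat.findGreatest (fun l => 0 < l ∧ 2 ^ l - 1 ≤ m) m
    let m0 := m - (2 ^ L - 1)
    if m0 ≤ 3 then q ^ m0 * (q ^ 2 ^ L - 1)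
    else if m0 < 2 ^ (L - 1) then
      if Odd m0 then (q ^ (2 ^ (L - 1) + m0) - 1) * (q ^ 2 ^ (L - 1) - 1)
      else q * (q ^ (2 ^ (L - 1) + m0 - 1) - 1) * (q ^ 2 ^ (L - 1) - 1)
    else if m0 = 2 ^ (L - 1) then (q ^ 2 ^ L + 1) * (q ^ 2 ^ (L - 1) - 1)
    else if Odd m0 then (q ^ m0 - 1) * (q ^ 2 ^ L - 1)
    else q * (q ^ (m0 - 1) - 1) * (q ^ 2 ^ L - 1)
  else if Odd m then
    -- the product of `q^(2^i) + 1` over the summands `2^i` of the 2-adic expansion of `m`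
    ∏ i ∈ Finset.range (m + 1), if m.testBit i then q ^ 2 ^ i + 1 else 1
  else if m = 2 then q ^ 2 + 1
  else
    -- `L` is the largest positive integer `ℓ` with `2^ℓ + 2^(ℓ-1) ≤ m`
    let L := Nat.findGreatest (fun l => 0 < l ∧ 2 ^ l + 2 ^ (l - 1) ≤ m) m
    (q ^ (m - 2 ^ L + 1) - 1) * (q ^ 2 ^ L - 1) / (q - 1)


theorem Mm_two_spec (m : ℕ) (hm : 1 ≤ m) : ∃ L : ℕ, 1 ≤ L ∧ 2 ^ L ≤ m + 1 ∧ m + 1 < 2 ^ (L + 1) ∧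
    Mm m 2 = (let m0 := m - (2 ^ L - 1)
      if m0 ≤ 3 then 2 ^ m0 * (2 ^ 2 ^ L - 1)
      else if m0 < 2 ^ (L - 1) then
        if Odd m0 then (2 ^ (2 ^ (L - 1) + m0) - 1) * (2 ^ 2 ^ (L - 1) - 1)
        else 2 * (2 ^ (2 ^ (L - 1) + m0 - 1) - 1) * (2 ^ 2 ^ (L - 1) - 1)
      else if m0 = 2 ^ (L - 1) then (2 ^ 2 ^ L + 1) * (2 ^ 2 ^ (L - 1) - 1)
      else if Odd m0 then (2 ^ m0 - 1) * (2 ^ 2 ^ L - 1)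
      else 2 * (2 ^ (m0 - 1) - 1) * (2 ^ 2 ^ L - 1)) := by
  set P : ℕ → Prop := fun l => 0 < l ∧ 2 ^ l - 1 ≤ m with hP
  set L := Nat.findGreatest P m with hL
  have h1 : P 1 := ⟨one_pos, by simpa using hm⟩
  have hPL : P L := Nat.findGreatest_spec hm h1
  have hp : 0 < 2 ^ L := by positivity
  refine ⟨L, hPL.1, by have := hPL.2; omega, ?_, ?_⟩
  · by_contra hcon
    push Not at hcon
    have hlt : L + 1 < 2 ^ (L + 1) := Nat.lt_two_pow_self
    have := Nat.le_findGreatest (P := P) (m := L + 1) (n := m) (by omega) ⟨by omega, by omega⟩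
    omega
  · rw [Mm, if_pos rfl]

theorem Mm_even_spec (m q : ℕ) (hq : q ≠ 2) (hm : Even m) (hm4 : 4 ≤ m) : ∃ L : ℕ, 1 ≤ L ∧
    3 * 2 ^ (L - 1) ≤ m ∧ m < 3 * 2 ^ L ∧
    Mm m q = (q ^ (m - 2 ^ L + 1) - 1) * (q ^ 2 ^ L - 1) / (q - 1) := by
  set P : ℕ → Prop := fun l => 0 < l ∧ 2 ^ l + 2 ^ (l - 1) ≤ m with hP
  set L := Nat.findGreatest P m with hL
  have h1 : P 1 := ⟨one_pos, by norm_num; omega⟩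
  have hPL : P L := Nat.findGreatest_spec (by omega) h1
  have hp : 0 < 2 ^ L := by positivity
  have h2 : 2 ^ L = 2 * 2 ^ (L - 1) := by
    rw [← pow_succ']; congr 1; have := hPL.1; omega
  refine ⟨L, hPL.1, by have := hPL.2; omega, ?_, ?_⟩
  · by_contra hcon
    push Not at hcon
    have hlt : L + 1 < 2 ^ (L + 1) := Nat.lt_two_pow_self
    have := Nat.le_findGreatest (P := P) (m := L + 1) (n := m) (by rw [pow_succ] at hlt; omega)
      ⟨by omega, by rw [pow_succ, Nat.add_sub_cancel]; omega⟩
    omega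
  · rw [Mm, if_neg hq, if_neg (Nat.not_odd_iff_even.2 hm), if_neg (by omega)]

theorem sum_testBit (m : ℕ) : ∑ i ∈ (Finset.range (m + 1)).filter (fun i => m.testBit i), 2 ^ i = m := by
  have h := Nat.sum_map_two_pow_bitIndices m
  have h2 : (Finset.range (m + 1)).filter (fun i => m.testBit i) = m.bitIndices.toFinset := by
    ext i
    simp only [Finset.mem_filter, Finset.mem_range, List.mem_toFinset, Nat.mem_bitIndices]
    constructor
    · exact fun h => h.2
    · intro h
      refine ⟨?_, h⟩
      have h1 := Nat.ge_two_pow_of_testBit h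
      have h3 : i < 2 ^ i := Nat.lt_two_pow_self
      omega
  rw [h2, List.sum_toFinset _ Nat.bitIndices_sorted.nodup]
  exact h

theorem Mm_odd_spec (m q : ℕ) (hq : q ≠ 2) (hm : Odd m) : ∃ E : Finset ℕ, ∑ i ∈ E, 2 ^ i = m ∧
    Mm m q = ∏ i ∈ E, (q ^ 2 ^ i + 1) := by
  refine ⟨_, sum_testBit m, ?_⟩
  rw [Mm, if_neg hq, if_pos hm, Finset.prod_filter]


theorem orbit_count {α : Type*} [DecidableEq α] (φ ι : α → α) (hφ : Function.Injective φ)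
    (hι : Function.Involutive ι) (hc : ∀ x, φ (ι x) = ι (φ x)) (S : Finset α)
    (hS : ∀ x ∈ S, φ x ∈ S) (hS' : ∀ x ∈ S, ι x ∈ S) (hne : ∀ x ∈ S, ι x ≠ x) :
    ∃ A D : Finset ℕ, (∀ a ∈ A, 0 < a) ∧ (∀ d ∈ D, 0 < d) ∧
      2 * (∑ a ∈ A, a + ∑ d ∈ D, d) ≤ S.card ∧
      ∀ x ∈ S, (∃ a ∈ A, φ^[a] x = x) ∨ (∃ d ∈ D, φ^[d] x = ι x) := by
  classical
  have hit : ∀ i, ∀ x ∈ S, φ^[i] x ∈ S := by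
    intro i
    induction i with
    | zero => intro x hx; simpa using hx
    | succ i ih => intro x hx; rw [Function.iterate_succ_apply]; exact ih _ (hS x hx)
  have hcit : ∀ i x, φ^[i] (ι x) = ι (φ^[i] x) := by
    intro i
    induction i with
    | zero => intro x; rfl
    | succ i ih => intro x; rw [Function.iterate_succ_apply, Function.iterate_succ_apply, hc, ih]
  have hinj : ∀ i, Function.Injective (φ^[i]) := fun i => hφ.iterate i
  have hper : ∀ x ∈ S, x ∈ Function.periodicPts φ := by
    intro x hx
    obtain ⟨i, j, hij, h⟩ : ∃ i j : ℕ, i < j ∧ φ^[i] x = φ^[j] x := by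
      by_contra! hcon
      have hinj' : Function.Injective (fun i : ℕ => (⟨φ^[i] x, hit i x hx⟩ : S)) := by
        intro i j h
        simp only [Subtype.mk.injEq] at h
        rcases lt_trichotomy i j with h1 | h1 | h1
        · exact absurd h (hcon i j h1)
        · exact h1
        · exact absurd h.symm (hcon j i h1)
      exact not_injective_infinite_finite _ hinj'
    refine ⟨j - i, by omega, ?_⟩
    have : φ^[i] (φ^[j - i] x) = φ^[i] x := by
      rw [← Function.iterate_add_apply, h]; congr 2; omega
    exact hinj i this
  set n : α → ℕ := fun x => Function.minimalPeriod φ x with hn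
  have hnpos : ∀ x ∈ S, 0 < n x := fun x hx => Function.minimalPeriod_pos_of_mem_periodicPts (hper x hx)
  have hnit : ∀ x ∈ S, ∀ i, n (φ^[i] x) = n x := fun x hx i =>
    Function.minimalPeriod_apply_iterate (hper x hx) i
  have hnι : ∀ x, n (ι x) = n x := by
    intro x
    apply Function.minimalPeriod_eq_minimalPeriod_iff.2
    intro k
    simp only [Function.IsPeriodicPt, Function.IsFixedPt, hcit]
    exact hι.injective.eq_iff
  set P : α → Prop := fun x => ∃ j, φ^[j] x = ι x with hP
  have hPit : ∀ i x, P (φ^[i] x) ↔ P x := by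
    intro i x
    constructor
    · rintro ⟨j, hj⟩
      refine ⟨j, hinj i ?_⟩
      rw [hcit, ← hj, ← Function.iterate_add_apply, ← Function.iterate_add_apply, add_comm]
    · rintro ⟨j, hj⟩
      refine ⟨j, ?_⟩
      rw [← hcit, ← hj, ← Function.iterate_add_apply, ← Function.iterate_add_apply, add_comm]
  have hPι : ∀ x, P x → P (ι x) := by
    rintro x ⟨j, hj⟩
    exact ⟨j, by rw [hcit, hj]⟩
  have hPι' : ∀ x, P (ι x) → P x := by
    intro x h; have := hPι _ h; rwa [hι x] at this
  have hPd : ∀ x ∈ S, P x → ∃ d, 0 < d ∧ n x = 2 * d ∧ φ^[d] x = ι x := by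
    rintro x hx ⟨j, hj⟩
    have h2 : φ^[j + j] x = x := by
      rw [Function.iterate_add_apply, hj, hcit, hj, hι]
    have hd : n x ∣ j + j := Function.IsPeriodicPt.minimalPeriod_dvd h2
    have hnd : ¬ n x ∣ j := by
      rintro ⟨k, hk⟩
      have : φ^[j] x = x := Function.isPeriodicPt_iff_minimalPeriod_dvd.2 ⟨k, hk⟩
      exact hne x hx (by rw [← hj, this])
    obtain ⟨e, he⟩ := hd
    have heo : ¬ 2 ∣ e := by
      rintro ⟨k, rfl⟩
      exact hnd ⟨k, by linarith⟩
    have hne2 : 2 ∣ n x := by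
      have : 2 ∣ n x * e := ⟨j, by omega⟩
      exact ((Nat.prime_two.dvd_mul).1 this).resolve_right heo
    obtain ⟨d, hd⟩ := hne2
    refine ⟨d, by have := hnpos x hx; omega, hd, ?_⟩
    have hjd : j = d * e := by rw [hd] at he; linarith
    obtain ⟨k, hk⟩ : ∃ k, e = 2 * k + 1 := ⟨e / 2, by omega⟩
    have : j = d + k * n x := by rw [hjd, hk, hd]; ring
    rw [← hj, this, Function.iterate_add_apply]
    congr 1
    exact (Function.isPeriodicPt_iff_minimalPeriod_dvd.2 (Dvd.intro_left k rfl)).symm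
  set SP := S.filter P with hSP
  set SN := S.filter (fun x => ¬ P x) with hSN
  have hcard : S.card = SP.card + SN.card := (Finset.card_filter_add_card_filter_not P).symm
  have horb : ∀ x ∈ S, ((Finset.range (n x)).image (fun i => φ^[i] x)).card = n x := by
    intro x hx
    rw [Finset.card_image_of_injOn, Finset.card_range]
    intro i hi j hj h
    have hi' := Finset.mem_range.1 hi
    have hj' := Finset.mem_range.1 hj
    exact (Function.iterate_eq_iterate_iff_of_lt_minimalPeriod hi' hj').1 h
  refine ⟨SN.image n, SP.image (fun x => n x / 2), ?_, ?_, ?_, ?_⟩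
  · intro a ha
    obtain ⟨x, hx, rfl⟩ := Finset.mem_image.1 ha
    exact hnpos x (Finset.mem_filter.1 hx).1
  · intro d hd
    obtain ⟨x, hx, rfl⟩ := Finset.mem_image.1 hd
    obtain ⟨hx, hp⟩ := Finset.mem_filter.1 hx
    obtain ⟨d, h1, h2, -⟩ := hPd x hx hp
    simp only [h2]; omega
  · have hA : ∑ a ∈ SN.image n, 2 * a ≤ SN.card := by
      rw [Finset.card_eq_sum_card_image n SN]
      apply Finset.sum_le_sum
      intro a ha
      obtain ⟨x, hx, rfl⟩ := Finset.mem_image.1 ha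
      obtain ⟨hx, hp⟩ := Finset.mem_filter.1 hx
      set O := (Finset.range (n x)).image (fun i => φ^[i] x)
      have hO : O.card = n x := horb x hx
      have hO' : (O.image ι).card = n x := by
        rw [Finset.card_image_of_injective _ hι.injective, hO]
      have hdisj : Disjoint O (O.image ι) := by
        rw [Finset.disjoint_left]
        intro y hy hy'
        obtain ⟨z, hz, rfl⟩ := Finset.mem_image.1 hy'
        obtain ⟨j, hj, rfl⟩ := Finset.mem_image.1 hz
        obtain ⟨i, hi, hi2⟩ := Finset.mem_image.1 hy
        -- φ^i x = ι (φ^j x)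
        have hjn := Finset.mem_range.1 hj
        apply hp
        refine ⟨n x - j + i, ?_⟩
        rw [Function.iterate_add_apply, hi2, hcit, ← Function.iterate_add_apply,
          Nat.sub_add_cancel hjn.le]
        congr 1
        exact Function.iterate_minimalPeriod
      calc 2 * n x = (O ∪ O.image ι).card := by
            rw [Finset.card_union_of_disjoint hdisj, hO, hO']; ring
        _ ≤ _ := by
          apply Finset.card_le_card
          intro y hy
          rcases Finset.mem_union.1 hy with hy | hy
          · obtain ⟨i, hi, rfl⟩ := Finset.mem_image.1 hy
            exact Finset.mem_filter.2 ⟨Finset.mem_filter.2 ⟨hit i x hx, fun h => hp ((hPit i x).1 h)⟩,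
              hnit x hx i⟩
          · obtain ⟨z, hz, rfl⟩ := Finset.mem_image.1 hy
            obtain ⟨i, hi, rfl⟩ := Finset.mem_image.1 hz
            exact Finset.mem_filter.2 ⟨Finset.mem_filter.2 ⟨hS' _ (hit i x hx),
              fun h => hp ((hPit i x).1 (hPι' _ h))⟩, by rw [hnι]; exact hnit x hx i⟩
    have hD : ∑ d ∈ SP.image (fun x => n x / 2), 2 * d ≤ SP.card := by
      rw [Finset.card_eq_sum_card_image (fun x => n x / 2) SP]
      apply Finset.sum_le_sum
      intro a ha
      obtain ⟨x, hx, rfl⟩ := Finset.mem_image.1 ha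
      obtain ⟨hx, hp⟩ := Finset.mem_filter.1 hx
      obtain ⟨d, h1, h2, -⟩ := hPd x hx hp
      calc 2 * (n x / 2) = n x := by omega
        _ = ((Finset.range (n x)).image (fun i => φ^[i] x)).card := (horb x hx).symm
        _ ≤ _ := by
          apply Finset.card_le_card
          intro y hy
          obtain ⟨i, hi, rfl⟩ := Finset.mem_image.1 hy
          exact Finset.mem_filter.2 ⟨Finset.mem_filter.2 ⟨hit i x hx, (hPit i x).2 hp⟩,
            by simp only [hnit x hx i]⟩
    rw [← Finset.mul_sum] at hA hD
    omega
  · intro x hx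
    by_cases hp : P x
    · right
      obtain ⟨d, h1, h2, h3⟩ := hPd x hx hp
      exact ⟨d, Finset.mem_image.2 ⟨x, Finset.mem_filter.2 ⟨hx, hp⟩, by simp only [h2]; omega⟩, h3⟩
    · left
      exact ⟨n x, Finset.mem_image.2 ⟨x, Finset.mem_filter.2 ⟨hx, hp⟩, rfl⟩,
        Function.iterate_minimalPeriod⟩


open Polynomial in
theorem mult_inv_le {K : Type*} [Field K] (p : K[X]) (hp : p ≠ 0) (c : K)
    (h : p = C c * p.reverse) (x : K) (hx : x ≠ 0) :
    p.rootMultiplicity x ≤ p.rootMultiplicity x⁻¹ := by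
  rw [le_rootMultiplicity_iff hp]
  have hrev : (X - C x : K[X]).reverse = -C x * (X - C x⁻¹) := by
    have h1 : (X - C x : K[X]) = X * 1 + C (-x) := by simp [sub_eq_add_neg]
    rw [h1, reverse_add_C, reverse_X_mul]
    have h2 : (1 : K[X]).reverse = 1 := by simpa using reverse_C (1 : K)
    have h3 : C x * C x⁻¹ = (1 : K[X]) := by rw [← C_mul, mul_inv_cancel₀ hx, C_1]
    rw [h2]
    simp only [mul_one, natDegree_X, pow_one, C_neg]
    first
    | linear_combination -h3
    | (simp; linear_combination -h3)
  have hpow : ∀ n : ℕ, ((X - C x : K[X]) ^ n).reverse = (-C x * (X - C x⁻¹)) ^ n := by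
    intro n
    induction n with
    | zero => simpa using reverse_C (1 : K)
    | succ n ih => rw [pow_succ, reverse_mul_of_domain, ih, hrev, pow_succ]
  obtain ⟨r, hr⟩ := pow_rootMultiplicity_dvd p x
  set n := rootMultiplicity x p
  have h4 : p.reverse = (-C x * (X - C x⁻¹)) ^ n * r.reverse := by
    conv_lhs => rw [hr]
    rw [reverse_mul_of_domain, hpow]
  rw [h, h4, mul_pow]
  exact ⟨C c * (-C x) ^ n * r.reverse, by ring⟩

/-- The cost (in half-dimensions) of a unipotent part of order `2 ^ k`. -/
def ucost (k : ℕ) : ℕ := if k = 0 then 0 else (2 ^ (k - 1) + 2) / 2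

open Polynomial in
theorem structure_thm (q m : ℕ) (F : Type) [Field F] [Fintype F] [CharP F 2]
    (hF : Fintype.card F = q) (g : Matrix.symplecticGroup (Fin m) F) :
    ∃ (k : ℕ) (A D : Finset ℕ), (∀ a ∈ A, 0 < a) ∧ (∀ d ∈ D, 0 < d) ∧
      ucost k + ∑ a ∈ A, a + ∑ d ∈ D, d ≤ m ∧
      ∀ N, 0 < N → (∀ a ∈ A, q ^ a - 1 ∣ N) → (∀ d ∈ D, q ^ d + 1 ∣ N) →
        orderOf g ≤ 2 ^ k * N := by
  classical
  set K := AlgebraicClosure F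
  have : CharP K 2 := charP_of_injective_algebraMap (algebraMap F K).injective 2
  set G : Matrix (Fin m ⊕ Fin m) (Fin m ⊕ Fin m) K := g.1.map (algebraMap F K) with hG
  have hGs : G ∈ Matrix.symplecticGroup (Fin m) K := SymplecticGroup.map_mem g.2 (algebraMap F K)
  set χ := G.charpoly with hχ
  have hχm : χ = g.1.charpoly.map (algebraMap F K) := by
    rw [hχ, hG]; exact Matrix.charpoly_map _ _
  have hmonic : χ.Monic := Matrix.charpoly_monic _
  have hχ0 : χ ≠ 0 := hmonic.ne_zero
  have hdeg : χ.natDegree = 2 * m := by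
    rw [hχ, Matrix.charpoly_natDegree_eq_dim]; simp; ring
  have hsplit : χ.Splits := IsAlgClosed.splits χ
  have hdetu : IsUnit G.det := SymplecticGroup.symplectic_det hGs
  have hrootne : ∀ x, χ.IsRoot x → x ≠ 0 := by
    rintro x hx rfl
    have h1 : χ.coeff 0 = 0 := by rw [coeff_zero_eq_eval_zero]; exact hx
    have h2 := G.det_eq_sign_charpoly_coeff
    rw [← hχ, h1, mul_zero] at h2
    exact hdetu.ne_zero h2
  have hrev : ∃ c : K, χ = C c * χ.reverse := by
    have hu : IsUnit G := (Matrix.isUnit_iff_isUnit_det G).2 hdetu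
    have h1 := Matrix.charpoly_inv G hu
    have h2 : G⁻¹.charpoly = χ := by
      have h3 : G⁻¹ = (-Matrix.J (Fin m) K) * (G.transpose * Matrix.J (Fin m) K) := by
        have := SymplecticGroup.inv_left_mul_aux hGs
        apply Matrix.inv_eq_left_inv
        rw [← this]
        simp only [Matrix.neg_mul, Matrix.mul_assoc]
      rw [h3, Matrix.charpoly_mul_comm, Matrix.mul_assoc, Matrix.mul_neg, Matrix.J_squared,
        neg_neg, Matrix.mul_one, Matrix.charpoly_transpose]
    rw [← Matrix.reverse_charpoly, h2] at h1
    refine ⟨(-1) ^ Fintype.card (Fin m ⊕ Fin m) * Ring.inverse G.det, ?_⟩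
    rw [C_mul, C_pow, C_neg, C_1]
    exact h1
  obtain ⟨c, hc⟩ := hrev
  have hminv : ∀ x, x ≠ 0 → χ.rootMultiplicity x⁻¹ = χ.rootMultiplicity x := by
    intro x hx
    apply le_antisymm
    · have := mult_inv_le χ hχ0 c hc x⁻¹ (inv_ne_zero hx)
      rwa [inv_inv] at this
    · exact mult_inv_le χ hχ0 c hc x hx
  have hq0 : 0 < q := hF ▸ Fintype.card_pos
  obtain ⟨f, hf⟩ : ∃ f : ℕ, q = 2 ^ f := by
    obtain ⟨n, -, h⟩ := FiniteField.card F 2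
    exact ⟨n, by rw [← hF, h]⟩
  -- Frobenius
  let φ : K →+* K := iterateFrobenius K 2 f
  have hφ : ∀ x, φ x = x ^ q := by intro x; rw [hf]; exact iterateFrobenius_def 2 f x
  have hφinj : Function.Injective φ := φ.injective
  have hφχ : χ.map φ = χ := by
    rw [hχm, Polynomial.map_map]
    congr 1
    ext x
    simp only [RingHom.comp_apply, hφ]
    rw [← map_pow, ← hF, FiniteField.pow_card]
  have hmφ : ∀ x, χ.rootMultiplicity (φ x) = χ.rootMultiplicity x := by
    intro x
    conv_lhs => rw [← hφχ]
    exact (eq_rootMultiplicity_map hφinj x).symm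
  set S : Finset K := χ.roots.toFinset.erase 1 with hS
  have hmemS : ∀ x, x ∈ S ↔ x ≠ 1 ∧ χ.IsRoot x := by
    intro x; rw [hS, Finset.mem_erase, Multiset.mem_toFinset, mem_roots hχ0]
  have hpos : ∀ x, χ.IsRoot x ↔ 0 < χ.rootMultiplicity x := by
    intro x; rw [rootMultiplicity_pos hχ0]
  have hit : ∀ i x, φ^[i] x = x ^ q ^ i := by
    intro i x
    induction i with
    | zero => simp
    | succ i ih => rw [Function.iterate_succ_apply', ih, hφ, ← pow_mul, pow_succ]
  have hsq : ∀ x : K, x ≠ 0 → x⁻¹ = x → x = 1 := by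
    intro x hx h
    have h1 : x ^ 2 = 1 := by rw [pow_two]; nth_rw 1 [← h]; exact inv_mul_cancel₀ hx
    have h2 : (x - 1) ^ 2 = 0 := by rw [sub_pow_char, h1]; simp
    exact sub_eq_zero.1 (pow_eq_zero_iff (two_ne_zero) |>.1 h2)
  have hSinv : ∀ x ∈ S, x⁻¹ ∈ S := by
    intro x hx
    rw [hmemS] at hx ⊢
    refine ⟨by rw [ne_eq, inv_eq_one]; exact hx.1, ?_⟩
    rw [hpos, hminv x (hrootne x hx.2), ← hpos]; exact hx.2
  have hSne : ∀ x ∈ S, x⁻¹ ≠ x := by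
    intro x hx h
    rw [hmemS] at hx
    exact hx.1 (hsq x (hrootne x hx.2) h)
  obtain ⟨A, D, hA, hD, hsum, hcov⟩ := orbit_count (φ : K → K) (fun x => x⁻¹) hφinj inv_involutive
    (fun x => map_inv₀ φ x) S
    (by
      intro x hx
      rw [hmemS] at hx ⊢
      refine ⟨fun h => hx.1 (hφinj (by rw [h, map_one])), ?_⟩
      rw [hpos, hmφ, ← hpos]; exact hx.2)
    hSinv hSne
  -- total multiplicity
  have htot : χ.rootMultiplicity 1 + ∑ x ∈ S, χ.rootMultiplicity x = 2 * m := by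
    have h1 : ∑ x ∈ insert 1 S, χ.rootMultiplicity x = χ.roots.card := by
      rw [← Multiset.sum_count_eq_card (s := insert 1 S)]
      · apply Finset.sum_congr rfl
        intro x _; rw [count_roots]
      · intro x hx
        rw [mem_roots hχ0] at hx
        rw [Finset.mem_insert, hmemS]
        tauto
    rw [Finset.sum_insert (by rw [hmemS]; tauto)] at h1
    rw [h1, ← hdeg]
    exact hsplit.natDegree_eq_card_roots.symm
  set e := (insert 1 S).sup (fun x => χ.rootMultiplicity x) with he
  obtain ⟨y, hy, hye⟩ := Finset.exists_mem_eq_sup (insert 1 S) ⟨1, Finset.mem_insert_self _ _⟩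
    (fun x => χ.rootMultiplicity x)
  have hle : ∀ x, χ.rootMultiplicity x ≤ e := by
    intro x
    by_cases hx : χ.IsRoot x
    · exact Finset.le_sup (f := fun x => χ.rootMultiplicity x)
        (by rw [Finset.mem_insert, hmemS]; tauto)
    · rw [hpos] at hx; omega
  have hcardS : S.card ≤ ∑ x ∈ S, χ.rootMultiplicity x := by
    rw [Finset.card_eq_sum_ones]
    apply Finset.sum_le_sum
    intro x hx
    exact (hpos x).1 ((hmemS x).1 hx).2
  have hek : ucost (Nat.clog 2 e) + ∑ a ∈ A, a + ∑ d ∈ D, d ≤ m := by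
    unfold ucost
    split_ifs with hk
    · omega
    set k := Nat.clog 2 e with hkdef
    have hlt : 2 ^ (k - 1) < e := by
      apply (Nat.lt_clog_iff_pow_lt (by norm_num)).1
      omega
    have hp : 0 < 2 ^ (k - 1) := by positivity
    rcases Finset.mem_insert.1 hy with h1 | h1
    · have : e = χ.rootMultiplicity 1 := by rw [he, hye, h1]
      omega
    · have hey : χ.rootMultiplicity y = e := hye.symm
      have hy0 := hrootne y ((hmemS y).1 h1).2
      have h2 : S.card + 2 * (e - 1) ≤ ∑ x ∈ S, χ.rootMultiplicity x := by
        have hsub : ({y, y⁻¹} : Finset K) ⊆ S := by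
          intro z hz
          rcases Finset.mem_insert.1 hz with h | h
          · rw [h]; exact h1
          · rw [Finset.mem_singleton.1 h]; exact hSinv y h1
        have h3 : ∑ x ∈ ({y, y⁻¹} : Finset K), (χ.rootMultiplicity x - 1) = 2 * (e - 1) := by
          rw [Finset.sum_pair (hSne y h1).symm, hminv y hy0, hey]; ring
        have h4 : ∑ x ∈ ({y, y⁻¹} : Finset K), (χ.rootMultiplicity x - 1)
            ≤ ∑ x ∈ S, (χ.rootMultiplicity x - 1) := Finset.sum_le_sum_of_subset hsub
        have h5 : ∑ x ∈ S, χ.rootMultiplicity x = ∑ x ∈ S, (χ.rootMultiplicity x - 1) + S.card := by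
          rw [Finset.card_eq_sum_ones, ← Finset.sum_add_distrib]
          apply Finset.sum_congr rfl
          intro x hx
          have := (hpos x).1 ((hmemS x).1 hx).2
          omega
        omega
      have : (2 ^ (k - 1) + 2) / 2 ≤ 2 ^ (k - 1) := by omega
      omega
  refine ⟨Nat.clog 2 e, A, D, hA, hD, hek, ?_⟩
  intro N hN hNA hND
  set k := Nat.clog 2 e with hkdef
  have hek2 : e ≤ 2 ^ k := Nat.le_pow_clog (by norm_num) e
  have hxN : ∀ x, χ.IsRoot x → x ^ N = 1 := by
    intro x hx
    have hx0 := hrootne x hx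
    by_cases h1 : x = 1
    · rw [h1, one_pow]
    rcases hcov x ((hmemS x).2 ⟨h1, hx⟩) with ⟨a, ha, h⟩ | ⟨d, hd, h⟩
    · rw [hit] at h
      obtain ⟨r, hr⟩ := hNA a ha
      have h2 : x ^ (q ^ a - 1) = 1 := by
        have h3 : x ^ (q ^ a - 1) * x = x := by
          rw [← pow_succ, Nat.sub_add_cancel (Nat.pos_of_ne_zero (by positivity)), h]
        exact mul_right_cancel₀ hx0 (by rw [h3, one_mul])
      rw [hr, pow_mul, h2, one_pow]
    · rw [hit] at h
      obtain ⟨r, hr⟩ := hND d hd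
      rw [hr, pow_mul, pow_succ, h, inv_mul_cancel₀ hx0, one_pow]
  have hP0 : (X ^ N - 1 : K[X]) ≠ 0 := by
    have := X_pow_sub_C_ne_zero hN (1 : K); rwa [C_1] at this
  have hdvd : χ ∣ (X ^ N - 1 : K[X]) ^ 2 ^ k := by
    have h1 : χ = (χ.roots.map (fun a => X - C a)).prod := hsplit.eq_prod_roots_of_monic hmonic
    rw [h1, Multiset.prod_X_sub_C_dvd_iff_le_roots (pow_ne_zero _ hP0), Multiset.le_iff_count]
    intro x
    rw [count_roots, count_roots]
    by_cases hx : χ.IsRoot x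
    · refine ((hle x).trans hek2).trans ?_
      rw [le_rootMultiplicity_iff (pow_ne_zero _ hP0)]
      apply pow_dvd_pow_of_dvd
      rw [dvd_iff_isRoot]
      simp [hxN x hx]
    · rw [hpos] at hx; omega
  have hGpow : G ^ (2 ^ k * N) = 1 := by
    have h1 : (X ^ N - 1 : K[X]) ^ 2 ^ k = X ^ (2 ^ k * N) - 1 := by
      rw [sub_pow_char_pow, one_pow, ← pow_mul, mul_comm]
    rw [h1] at hdvd
    obtain ⟨r, hr⟩ := hdvd
    have h2 : aeval G (X ^ (2 ^ k * N) - 1 : K[X]) = 0 := by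
      rw [hr, map_mul, hχ, Matrix.aeval_self_charpoly, zero_mul]
    simpa [sub_eq_zero] using h2
  have hgpow : g ^ (2 ^ k * N) = 1 := by
    apply Subtype.ext
    have h1 : (g.1 ^ (2 ^ k * N)).map (algebraMap F K) = (1 : Matrix _ _ F).map (algebraMap F K) := by
      have h3 := map_pow (RingHom.mapMatrix (m := Fin m ⊕ Fin m) (algebraMap F K)) g.1 (2 ^ k * N)
      rw [RingHom.mapMatrix_apply, RingHom.mapMatrix_apply] at h3
      rw [h3, ← hG, hGpow]
      simp
    have h2 := Matrix.map_injective (algebraMap F K).injective h1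
    simpa using h2
  exact orderOf_le_of_pow_eq_one (by positivity) hgpow


section blk
variable {F K : Type*} [Field F] [Field K] [Algebra F K] {d : ℕ}

/-- Matrices of twisted trace forms. -/
noncomputable def blk (F : Type*) {K : Type*} [Field F] [Field K] [Algebra F K] {d : ℕ}
    (u v : Fin d → K) (x : K) : Matrix (Fin d) (Fin d) F :=
  Matrix.of fun i j => Algebra.trace F K (u i * x * v j)

theorem blk_transpose (u v : Fin d → K) (x : K) : (blk F u v x).transpose = blk F v u x := by
  ext i j
  simp only [blk, Matrix.transpose_apply, Matrix.of_apply]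
  congr 1; ring

theorem blk_add (u v : Fin d → K) (x y : K) : blk F u v (x + y) = blk F u v x + blk F u v y := by
  ext i j
  simp only [blk, Matrix.add_apply, Matrix.of_apply, ← map_add]
  congr 1; ring

theorem blk_neg (u v : Fin d → K) (x : K) : blk F u v (-x) = -blk F u v x := by
  ext i j
  simp only [blk, Matrix.neg_apply, Matrix.of_apply, ← map_neg]
  congr 1; ring

theorem blk_zero (u v : Fin d → K) : blk F u v 0 = 0 := by
  ext i j
  simp [blk]

/-- Two families are trace-dual with the completeness relation. -/
def DualFam (F : Type*) {K : Type*} [Field F] [Field K] [Algebra F K] {d : ℕ}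
    (b b' : Fin d → K) : Prop :=
  (∀ i j, Algebra.trace F K (b i * b' j) = if i = j then 1 else 0) ∧
  (∀ x : K, x = ∑ i, Algebra.trace F K (b' i * x) • b i)

theorem blk_mul {b b' : Fin d → K} (h : DualFam F b b') (u v : Fin d → K) (x y : K) :
    blk F u b x * blk F b' v y = blk F u v (x * y) := by
  ext i j
  simp only [blk, Matrix.mul_apply, Matrix.of_apply]
  have h1 := h.2 (y * v j)
  have h2 : u i * (x * y) * v j = ∑ k, Algebra.trace F K (b' k * (y * v j)) • (u i * x * b k) := by
    calc u i * (x * y) * v j = u i * x * (y * v j) := by ring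
      _ = u i * x * ∑ i, Algebra.trace F K (b' i * (y * v j)) • b i := by rw [← h1]
      _ = _ := by
        rw [Finset.mul_sum]
        apply Finset.sum_congr rfl
        intro k _
        rw [mul_smul_comm]
  rw [h2, map_sum]
  apply Finset.sum_congr rfl
  intro k _
  rw [map_smul, smul_eq_mul, mul_comm, mul_assoc (b' k)]

theorem blk_one {b b' : Fin d → K} (h : DualFam F b b') : blk F b b' 1 = 1 := by
  ext i j
  simp only [blk, Matrix.of_apply, mul_one, h.1, Matrix.one_apply]

theorem blk_inj {b b' : Fin d → K} (h : DualFam F b b') (hd : 0 < d) {w w' : Fin d → K}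
    (h' : DualFam F w w') {x y : K}
    (hxy : blk F b' w x = blk F b' w y) : x = y := by
  have h0 : w ⟨0, hd⟩ ≠ 0 := by
    intro h0
    have := h'.1 ⟨0, hd⟩ ⟨0, hd⟩
    simp [h0] at this
  apply mul_right_cancel₀ h0
  rw [h.2 (x * _), h.2 (y * _)]
  apply Finset.sum_congr rfl
  intro i _
  have := congrFun (congrFun hxy i) ⟨0, hd⟩
  simp only [blk, Matrix.of_apply] at this
  rw [← mul_assoc, this, mul_assoc]

theorem exists_dualFam [Finite K] (hd : Module.finrank F K = d) :
    ∃ b b' : Fin d → K, DualFam F b b' ∧ DualFam F b' b := by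
  have : Finite F := Finite.of_injective _ (algebraMap F K).injective
  have hnd := traceForm_nondegenerate F K
  let b : Module.Basis (Fin d) F K := Module.finBasisOfFinrankEq F K hd
  let b' : Module.Basis (Fin d) F K := (Algebra.traceForm F K).dualBasis hnd b
  have h1 : ∀ i j, Algebra.trace F K (b i * b' j) = if i = j then 1 else 0 := by
    intro i j
    exact LinearMap.BilinForm.apply_dualBasis_right hnd (Algebra.traceForm_isSymm F) b i j
  have h1' : ∀ i j, Algebra.trace F K (b' i * b j) = if i = j then 1 else 0 := by
    intro i j
    rw [mul_comm, h1]; simp only [eq_comm]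
  refine ⟨b, b', ⟨h1, ?_⟩, ⟨h1', ?_⟩⟩
  · intro x
    conv_lhs => rw [← b.sum_repr x]
    apply Finset.sum_congr rfl
    intro i _
    congr 1
    conv_rhs => rw [← b.sum_repr x]
    rw [Finset.mul_sum, map_sum]
    simp [h1']
  · intro x
    conv_lhs => rw [← b'.sum_repr x]
    apply Finset.sum_congr rfl
    intro i _
    congr 1
    conv_rhs => rw [← b'.sum_repr x]
    rw [Finset.mul_sum, map_sum]
    simp [h1]

/-- The matrix over `F` attached to a two by two matrix over `K`. -/
noncomputable def resMat (F : Type*) {K : Type*} [Field F] [Field K] [Algebra F K] {d : ℕ}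
    (b b' : Fin d → K) (M : Matrix (Fin 2) (Fin 2) K) :
    Matrix (Fin d ⊕ Fin d) (Fin d ⊕ Fin d) F :=
  Matrix.fromBlocks (blk F b' b (M 0 0)) (blk F b' b' (M 0 1)) (blk F b b (M 1 0)) (blk F b b' (M 1 1))

theorem resMat_mul {b b' : Fin d → K} (h : DualFam F b b') (h' : DualFam F b' b)
    (M N : Matrix (Fin 2) (Fin 2) K) :
    resMat F b b' (M * N) = resMat F b b' M * resMat F b b' N := by
  simp only [resMat, Matrix.fromBlocks_multiply, blk_mul h, blk_mul h', ← blk_add,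
    Matrix.mul_apply, Fin.sum_univ_two]

theorem resMat_one {b b' : Fin d → K} (h : DualFam F b b') (h' : DualFam F b' b) :
    resMat F b b' 1 = 1 := by
  simp [resMat, blk_one h, blk_one h', blk_zero]

theorem resMat_mem {b b' : Fin d → K} (h : DualFam F b b') (h' : DualFam F b' b)
    (M : Matrix (Fin 2) (Fin 2) K) (hM : M.det = 1) :
    resMat F b b' M ∈ Matrix.symplecticGroup (Fin d) F := by
  rw [SymplecticGroup.mem_iff]
  rw [Matrix.det_fin_two] at hM
  simp only [resMat, Matrix.J, Matrix.fromBlocks_transpose, blk_transpose,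
    Matrix.fromBlocks_multiply, Matrix.mul_zero, Matrix.mul_one, Matrix.mul_neg, zero_add, add_zero,
    Matrix.neg_mul, ← blk_neg, blk_mul h, blk_mul h', ← blk_add]
  have e1 : M 0 1 * M 0 0 + -(M 0 0) * M 0 1 = 0 := by ring
  have e2 : M 0 1 * M 1 0 + -(M 0 0) * M 1 1 = -1 := by linear_combination -hM
  have e3 : M 1 1 * M 0 0 + -(M 1 0) * M 0 1 = 1 := by linear_combination hM
  have e4 : M 1 1 * M 1 0 + -(M 1 0) * M 1 1 = 0 := by ring
  rw [e1, e2, e3, e4, blk_zero, blk_zero, blk_neg, blk_one h, blk_one h']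

theorem exists_hom [Finite K] (hd : Module.finrank F K = d) (hd0 : 0 < d) :
    ∃ T : Matrix.SpecialLinearGroup (Fin 2) K →* Matrix.symplecticGroup (Fin d) F,
      Function.Injective T := by
  obtain ⟨b, b', h, h'⟩ := exists_dualFam (F := F) hd
  refine ⟨{ toFun := fun M => ⟨resMat F b b' M.1, resMat_mem h h' M.1 M.2⟩
            map_one' := Subtype.ext (by simpa using resMat_one h h')
            map_mul' := fun M N => Subtype.ext (by simpa using resMat_mul h h' M.1 N.1) }, ?_⟩
  intro M N hMN
  have h1 : resMat F b b' M.1 = resMat F b b' N.1 := congrArg Subtype.val hMN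
  simp only [resMat, Matrix.fromBlocks_inj] at h1
  obtain ⟨h2, h3, h4, h5⟩ := h1
  apply Matrix.SpecialLinearGroup.ext
  intro i j
  fin_cases i <;> fin_cases j
  · exact blk_inj h hd0 h h2
  · exact blk_inj h hd0 h' h3
  · exact blk_inj h' hd0 h h4
  · exact blk_inj h' hd0 h' h5

end blk


/-- `Sp_{2m}(F)` has an element of order `N`. -/
def Ach (F : Type) [Field F] (m N : ℕ) : Prop :=
  ∃ g : Matrix.symplecticGroup (Fin m) F, orderOf g = N

theorem ach_one (F : Type) [Field F] (m : ℕ) : Ach F m 1 := ⟨1, orderOf_one⟩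

section
variable {F : Type} [Field F]

/-- The direct sum of two symplectic matrices. -/
def dsum {l l' : Type} [DecidableEq l] [Fintype l] [DecidableEq l'] [Fintype l']
    (g : Matrix (l ⊕ l) (l ⊕ l) F) (h : Matrix (l' ⊕ l') (l' ⊕ l') F) :
    Matrix ((l ⊕ l') ⊕ (l ⊕ l')) ((l ⊕ l') ⊕ (l ⊕ l')) F :=
  (Matrix.fromBlocks g 0 0 h).submatrix (Equiv.sumSumSumComm l l' l l') (Equiv.sumSumSumComm l l' l l')

theorem dsum_mul {l l' : Type} [DecidableEq l] [Fintype l] [DecidableEq l'] [Fintype l']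
    (g g₁ : Matrix (l ⊕ l) (l ⊕ l) F) (h h₁ : Matrix (l' ⊕ l') (l' ⊕ l') F) :
    dsum (g * g₁) (h * h₁) = dsum g h * dsum g₁ h₁ := by
  simp [dsum, Matrix.submatrix_mul_equiv, Matrix.fromBlocks_multiply]

theorem dsum_one {l l' : Type} [DecidableEq l] [Fintype l] [DecidableEq l'] [Fintype l'] :
    dsum (1 : Matrix (l ⊕ l) (l ⊕ l) F) (1 : Matrix (l' ⊕ l') (l' ⊕ l') F) = 1 := by
  simp [dsum]

theorem dsum_J {l l' : Type} [DecidableEq l] [Fintype l] [DecidableEq l'] [Fintype l'] :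
    dsum (Matrix.J l F) (Matrix.J l' F) = Matrix.J (l ⊕ l') F := by
  ext i j
  rcases i with (i | i) | (i | i) <;> rcases j with (j | j) | (j | j) <;>
    simp [dsum, Matrix.J, Matrix.one_apply]

theorem dsum_transpose {l l' : Type} [DecidableEq l] [Fintype l] [DecidableEq l'] [Fintype l']
    (g : Matrix (l ⊕ l) (l ⊕ l) F) (h : Matrix (l' ⊕ l') (l' ⊕ l') F) :
    (dsum g h).transpose = dsum g.transpose h.transpose := by
  simp [dsum, Matrix.fromBlocks_transpose]

/-- The embedding of `Sp × Sp` in `Sp`. -/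
def dsumHom (l l' : Type) [DecidableEq l] [Fintype l] [DecidableEq l'] [Fintype l'] :
    Matrix.symplecticGroup l F × Matrix.symplecticGroup l' F →* Matrix.symplecticGroup (l ⊕ l') F where
  toFun p := ⟨dsum p.1.1 p.2.1, by
    rw [SymplecticGroup.mem_iff, ← dsum_J, dsum_transpose, ← dsum_mul, ← dsum_mul,
      SymplecticGroup.mem_iff.1 p.1.2, SymplecticGroup.mem_iff.1 p.2.2]⟩
  map_one' := Subtype.ext (by simpa using dsum_one)
  map_mul' p p' := Subtype.ext (by simpa using dsum_mul _ _ _ _)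

theorem dsumHom_inj (l l' : Type) [DecidableEq l] [Fintype l] [DecidableEq l'] [Fintype l'] :
    Function.Injective (dsumHom (F := F) l l') := by
  rintro ⟨p, q⟩ ⟨p', q'⟩ h
  have h1 : dsum p.1 q.1 = dsum p'.1 q'.1 := congrArg Subtype.val h
  have h2 : Matrix.fromBlocks p.1 0 0 q.1 = Matrix.fromBlocks p'.1 0 0 q'.1 := by
    ext i j
    have := congrFun (congrFun h1 ((Equiv.sumSumSumComm l l' l l').symm i))
      ((Equiv.sumSumSumComm l l' l l').symm j)
    simpa only [dsum, Matrix.submatrix_apply, Equiv.apply_symm_apply] using this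
  rw [Matrix.fromBlocks_inj] at h2
  exact Prod.ext (Subtype.ext h2.1) (Subtype.ext h2.2.2.2)

/-- Reindexing of symplectic groups. -/
def spReindex {l l' : Type} [DecidableEq l] [Fintype l] [DecidableEq l'] [Fintype l'] (e : l' ≃ l) :
    Matrix.symplecticGroup l F →* Matrix.symplecticGroup l' F where
  toFun p := ⟨p.1.submatrix (Equiv.sumCongr e e) (Equiv.sumCongr e e), by
    have hJ : Matrix.J l' F = (Matrix.J l F).submatrix (Equiv.sumCongr e e) (Equiv.sumCongr e e) := by
      ext i j
      rcases i with i | i <;> rcases j with j | j <;>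
        simp [Matrix.J, Matrix.one_apply]
    rw [SymplecticGroup.mem_iff, hJ, Matrix.transpose_submatrix, Matrix.submatrix_mul_equiv,
      Matrix.submatrix_mul_equiv, SymplecticGroup.mem_iff.1 p.2]⟩
  map_one' := Subtype.ext (by simp)
  map_mul' p p' := Subtype.ext (by simp [Matrix.submatrix_mul_equiv])

theorem spReindex_inj {l l' : Type} [DecidableEq l] [Fintype l] [DecidableEq l'] [Fintype l'] (e : l' ≃ l) :
    Function.Injective (spReindex (F := F) e) := by
  intro p q h
  have h1 : p.1.submatrix (Equiv.sumCongr e e) (Equiv.sumCongr e e) =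
    q.1.submatrix (Equiv.sumCongr e e) (Equiv.sumCongr e e) := congrArg Subtype.val h
  apply Subtype.ext
  ext i j
  have := congrFun (congrFun h1 ((Equiv.sumCongr e e).symm i)) ((Equiv.sumCongr e e).symm j)
  simpa only [Matrix.submatrix_apply, Equiv.apply_symm_apply] using this

theorem ach_add {a b N M : ℕ} (h1 : Ach F a N) (h2 : Ach F b M) (hc : Nat.Coprime N M) :
    Ach F (a + b) (N * M) := by
  obtain ⟨g, hg⟩ := h1
  obtain ⟨h, hh⟩ := h2
  refine ⟨spReindex (finSumFinEquiv.symm) (dsumHom (Fin a) (Fin b) (g, h)), ?_⟩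
  rw [orderOf_injective _ (spReindex_inj _), orderOf_injective _ (dsumHom_inj _ _), Prod.orderOf,
    hg, hh, hc.lcm_eq_mul]

theorem ach_minus [Finite F] [CharP F 2] (d : ℕ) (hd : 0 < d) : Ach F d (Nat.card F ^ d - 1) := by
  have : NeZero d := ⟨hd.ne'⟩
  obtain ⟨T, hT⟩ := exists_hom (F := F) (K := FiniteField.Extension F 2 d)
    (FiniteField.finrank_extension F 2 d) hd
  set K := FiniteField.Extension F 2 d
  obtain ⟨u, hu⟩ := IsCyclic.exists_ofOrder_eq_natCard (α := Kˣ)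
  have hcard : Nat.card Kˣ = Nat.card F ^ d - 1 := by
    rw [Nat.card_units, FiniteField.natCard_extension]
  let f : Kˣ →* Matrix.SpecialLinearGroup (Fin 2) K :=
    { toFun := fun u => ⟨!![(u : K), 0; 0, (u⁻¹ : Kˣ)], by simp⟩
      map_one' := by
        apply Subtype.ext
        simp [Matrix.one_fin_two]
      map_mul' := fun u v => by
        apply Subtype.ext
        change _ = !![(u : K), 0; 0, (u⁻¹ : Kˣ)] * !![(v : K), 0; 0, (v⁻¹ : Kˣ)]
        rw [Matrix.mul_fin_two]
        simp [mul_comm] }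
  have hf : Function.Injective f := by
    intro u v h
    have h1 := congrArg (fun M : Matrix.SpecialLinearGroup (Fin 2) K => M.1 0 0) h
    exact Units.ext h1
  exact ⟨T (f u), by rw [orderOf_injective _ hT, orderOf_injective _ hf, hu, hcard]⟩

theorem ach_plus [Finite F] [CharP F 2] (d : ℕ) (hd : 0 < d) : Ach F d (Nat.card F ^ d + 1) := by
  have : NeZero d := ⟨hd.ne'⟩
  obtain ⟨T, hT⟩ := exists_hom (F := F) (K := FiniteField.Extension F 2 d)
    (FiniteField.finrank_extension F 2 d) hd
  set K := FiniteField.Extension F 2 d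
  have : CharP K 2 := charP_of_injective_algebraMap (algebraMap F K).injective 2
  set E := FiniteField.Extension K 2 2
  have hcK : Nat.card K = Nat.card F ^ d := FiniteField.natCard_extension F 2 d
  have hcE : Nat.card E = (Nat.card F ^ d) ^ 2 := by
    rw [← hcK]; exact FiniteField.natCard_extension K 2 2
  set Q := Nat.card F ^ d with hQ
  have hQ1 : 1 < Q := Nat.one_lt_pow hd.ne' Finite.one_lt_card
  obtain ⟨u, hu⟩ := IsCyclic.exists_ofOrder_eq_natCard (α := Eˣ)
  have hfac : Q ^ 2 - 1 = (Q - 1) * (Q + 1) := by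
    obtain ⟨r, hr⟩ : ∃ r, Q = r + 1 := ⟨Q - 1, by omega⟩
    rw [hr]; simp only [Nat.add_sub_cancel]
    apply Nat.sub_eq_of_eq_add; ring
  rw [Nat.card_units, hcE, hfac] at hu
  set y : Eˣ := u ^ (Q - 1) with hy
  have hoy : orderOf y = Q + 1 := by
    rw [hy, orderOf_pow_of_dvd (by omega) (by rw [hu]; exact Dvd.intro _ rfl), hu,
      Nat.mul_div_cancel_left _ (by omega)]
  have hnorm : Algebra.norm K (y : E) = 1 := by
    apply (algebraMap K E).injective
    rw [FiniteField.algebraMap_norm_eq_pow, hcE, hcK, hfac, Nat.mul_div_cancel_left _ (by omega),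
      map_one, ← Units.val_pow_eq_pow_val, ← hoy, pow_orderOf_eq_one, Units.val_one]
  let b : Module.Basis (Fin 2) K E := Module.finBasisOfFinrankEq K E (FiniteField.finrank_extension K 2 2)
  let M : Matrix.SpecialLinearGroup (Fin 2) K := ⟨Algebra.leftMulMatrix b y, by
    rw [← Algebra.norm_eq_matrix_det, hnorm]⟩
  refine ⟨T M, ?_⟩
  rw [orderOf_injective _ hT, ← hoy]
  apply orderOf_eq_orderOf_iff.2
  intro n
  constructor
  · intro h
    have h1 : (M ^ n).1 = 1 := by rw [h]; rfl
    rw [Matrix.SpecialLinearGroup.coe_pow] at h1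
    have h2 : Algebra.leftMulMatrix b ((y : E) ^ n) = Algebra.leftMulMatrix b 1 := by
      rw [map_pow, map_one]; exact h1
    have := Algebra.leftMulMatrix_injective b h2
    exact Units.ext (by simpa using this)
  · intro h
    apply Subtype.ext
    rw [Matrix.SpecialLinearGroup.coe_pow]
    change (Algebra.leftMulMatrix b (y : E)) ^ n = 1
    rw [← map_pow, ← Units.val_pow_eq_pow_val, h]
    simp

theorem ach_of_zmod2 [CharP F 2] {m N : ℕ} (h : Ach (ZMod 2) m N) : Ach F m N := by
  obtain ⟨g, hg⟩ := h
  let f : ZMod 2 →+* F := ZMod.castHom (dvd_refl 2) F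
  refine ⟨⟨g.1.map f, SymplecticGroup.map_mem g.2 f⟩, ?_⟩
  rw [← hg]
  apply orderOf_eq_orderOf_iff.2
  intro n
  have h1 : (g.1 ^ n).map f = (g.1.map f) ^ n := by
    have h3 := map_pow (RingHom.mapMatrix (m := Fin m ⊕ Fin m) f) g.1 n
    rwa [RingHom.mapMatrix_apply, RingHom.mapMatrix_apply] at h3
  rw [Subtype.ext_iff, Subtype.ext_iff]
  simp only [SubmonoidClass.coe_pow, OneMemClass.coe_one]
  rw [← h1]
  constructor
  · intro h
    apply Matrix.map_injective f.injective
    change (g.1 ^ n).map f = (1 : Matrix _ _ (ZMod 2)).map f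
    rw [h]; simp
  · intro h
    rw [h]; simp

end

theorem ach_uni {n : ℕ} {m : ℕ} (g : Matrix (Fin m ⊕ Fin m) (Fin m ⊕ Fin m) (ZMod 2))
    (hg : g * Matrix.J (Fin m) (ZMod 2) * g.transpose = Matrix.J (Fin m) (ZMod 2))
    (h1 : g ^ 2 ^ n ≠ 1) (h2 : g ^ 2 ^ (n + 1) = 1) : Ach (ZMod 2) m (2 ^ (n + 1)) := by
  refine ⟨⟨g, SymplecticGroup.mem_iff.2 hg⟩, ?_⟩
  apply orderOf_eq_prime_pow
  · intro h
    exact h1 (by simpa using congrArg Subtype.val h)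
  · exact Subtype.ext (by simpa using h2)

theorem ach_2 : Ach (ZMod 2) 1 2 := by
  apply ach_uni (n := 0) (Matrix.fromBlocks 1 1 0 1) <;> decide +kernel

theorem ach_4 : Ach (ZMod 2) 2 4 := by
  apply ach_uni (n := 1) (Matrix.fromBlocks !![1, 1; 0, 1] !![0, 1; 0, 1] 0 !![1, 0; 1, 1]) <;>
    decide +kernel

theorem ach_8 : Ach (ZMod 2) 3 8 := by
  apply ach_uni (n := 2) (Matrix.fromBlocks !![1, 1, 0; 0, 1, 1; 0, 0, 1]
    !![0, 0, 0; 0, 0, 1; 0, 0, 1] 0 !![1, 0, 0; 1, 1, 0; 1, 1, 1]) <;> decide +kernel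

section lower


theorem two_pow_minus_dvd (q i j : ℕ) (h : i ≤ j) : q ^ 2 ^ i - 1 ∣ q ^ 2 ^ j - 1 :=
  Nat.pow_sub_one_dvd_pow_sub_one q (pow_dvd_pow 2 h)

theorem plus_dvd_minus (q i : ℕ) : q ^ 2 ^ i + 1 ∣ q ^ 2 ^ (i + 1) - 1 := by
  refine ⟨q ^ 2 ^ i - 1, ?_⟩
  rw [pow_succ, pow_mul, ← Nat.sq_sub_sq, one_pow]

theorem eq_one_of_dvd_pm {q i d : ℕ} (hq : Even q) (h1 : d ∣ q ^ 2 ^ i - 1)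
    (h2 : d ∣ q ^ 2 ^ i + 1) (hq0 : 0 < q) : d = 1 := by
  have hp : 0 < q ^ 2 ^ i := by positivity
  have h3 : d ∣ 2 := by
    have := Nat.dvd_sub h2 h1
    rwa [show q ^ 2 ^ i + 1 - (q ^ 2 ^ i - 1) = 2 by omega] at this
  have h4 : Even (q ^ 2 ^ i) := hq.pow_of_ne_zero (by positivity)
  rcases (Nat.dvd_prime Nat.prime_two).1 h3 with h | h
  · exact h
  · subst h
    obtain ⟨r, hr⟩ := h4
    omega

theorem coprime_pp {q i j : ℕ} (hq : Even q) (hq0 : 0 < q) (hij : i < j) :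
    Nat.Coprime (q ^ 2 ^ i + 1) (q ^ 2 ^ j + 1) := by
  refine eq_one_of_dvd_pm (i := j) hq ?_ (Nat.gcd_dvd_right _ _) hq0
  exact (Nat.gcd_dvd_left _ _).trans ((plus_dvd_minus q i).trans (two_pow_minus_dvd q _ _ hij))

theorem coprime_mp {q a i : ℕ} (hq : Even q) (hq0 : 0 < q) (ha : Odd a) :
    Nat.Coprime (q ^ a - 1) (q ^ 2 ^ i + 1) := by
  refine eq_one_of_dvd_pm (i := i) hq ?_ (Nat.gcd_dvd_right _ _) hq0
  have h1 : Nat.gcd (q ^ a - 1) (q ^ 2 ^ i + 1) ∣ Nat.gcd (q ^ a - 1) (q ^ 2 ^ (i + 1) - 1) :=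
    Nat.gcd_dvd_gcd_of_dvd_right _ (plus_dvd_minus q i)
  rw [Nat.pow_sub_one_gcd_pow_sub_one,
    show Nat.gcd a (2 ^ (i + 1)) = 1 from
      Nat.Coprime.pow_right _ (Nat.coprime_two_right.2 ha)] at h1
  exact h1.trans (Nat.pow_sub_one_dvd_pow_sub_one q (one_dvd _))

theorem coprime_mprod {q a : ℕ} (hq : Even q) (hq0 : 0 < q) (ha : Odd a) (E : Finset ℕ) :
    Nat.Coprime (q ^ a - 1) (∏ i ∈ E, (q ^ 2 ^ i + 1)) :=
  Nat.Coprime.prod_right fun _ _ => coprime_mp hq hq0 ha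

theorem telescope (q L : ℕ) (hq0 : 0 < q) :
    (∏ i ∈ Finset.range L, (q ^ 2 ^ i + 1)) * (q - 1) = q ^ 2 ^ L - 1 := by
  induction L with
  | zero => simp
  | succ n ih =>
    rw [Finset.prod_range_succ, mul_right_comm, ih, pow_succ 2, pow_mul, mul_comm,
      ← Nat.sq_sub_sq, one_pow]

theorem sum_two_pow (L : ℕ) : ∑ i ∈ Finset.range L, 2 ^ i = 2 ^ L - 1 := by
  have := Nat.geomSum_eq (le_refl 2) L
  simpa using this

variable {F : Type} [Field F]

theorem ach_prod [Finite F] [CharP F 2] {q : ℕ} (hF : Nat.card F = q) (hq : Even q) (hq0 : 0 < q)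
    (E : Finset ℕ) : Ach F (∑ i ∈ E, 2 ^ i) (∏ i ∈ E, (q ^ 2 ^ i + 1)) := by
  induction E using Finset.induction_on with
  | empty => simpa using ach_one F 0
  | insert i s hi ih =>
    rw [Finset.sum_insert hi, Finset.prod_insert hi]
    refine ach_add ?_ ih ?_
    · have := ach_plus (F := F) (2 ^ i) (by positivity)
      rwa [hF] at this
    · refine Nat.Coprime.prod_right fun j hj => ?_
      have hne : i ≠ j := fun h => hi (h ▸ hj)
      rcases lt_or_gt_of_ne hne with h | h
      · exact coprime_pp hq hq0 h
      · exact (coprime_pp hq hq0 h).symm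

theorem ach_W [Finite F] [CharP F 2] {q : ℕ} (hF : Nat.card F = q) (hq : Even q) (hq0 : 0 < q)
    (L : ℕ) : Ach F (2 ^ L - 1) (∏ i ∈ Finset.range L, (q ^ 2 ^ i + 1)) := by
  have := ach_prod hF hq hq0 (Finset.range L)
  rwa [sum_two_pow] at this

theorem ach_W2 [Finite F] [CharP F 2] (hF : Nat.card F = 2)
    (L : ℕ) : Ach F (2 ^ L - 1) (2 ^ 2 ^ L - 1) := by
  have := ach_W hF even_two two_pos L
  rwa [show ∏ i ∈ Finset.range L, (2 ^ 2 ^ i + 1) = 2 ^ 2 ^ L - 1 by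
    simpa using telescope 2 L two_pos] at this

theorem coprime_mW2 {a L : ℕ} (ha : Odd a) : Nat.Coprime (2 ^ a - 1) (2 ^ 2 ^ L - 1) := by
  have := coprime_mprod even_two two_pos ha (Finset.range L)
  rwa [show ∏ i ∈ Finset.range L, (2 ^ 2 ^ i + 1) = 2 ^ 2 ^ L - 1 by
    simpa using telescope 2 L two_pos] at this

theorem odd_two_pow_sub (n : ℕ) (hn : 0 < n) : Odd (2 ^ n - 1) := by
  obtain ⟨k, rfl⟩ : ∃ k, n = k + 1 := ⟨n - 1, by omega⟩
  have : 0 < 2 ^ k := by positivity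
  exact ⟨2 ^ k - 1, by rw [pow_succ]; omega⟩

theorem ach_cast {m m' N N' : ℕ} (h : Ach F m N) (hm : m = m') (hN : N = N') : Ach F m' N' := by
  subst hm; subst hN; exact h

theorem lower_two [Finite F] [CharP F 2] (hF : Nat.card F = 2) (m : ℕ) (hm : 1 ≤ m) :
    Ach F m (Mm m 2) := by
  obtain ⟨L, hL, h1, h2, h3⟩ := Mm_two_spec m hm
  rw [h3]
  dsimp only
  have hpL : 2 ^ L = 2 * 2 ^ (L - 1) := by rw [← pow_succ']; congr 1; omega
  have hpL' : 2 ^ (L + 1) = 2 * 2 ^ L := pow_succ' 2 L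
  set m0 := m - (2 ^ L - 1) with hm0
  have hmin : ∀ d, 0 < d → Ach F d (2 ^ d - 1) := fun d hd => by
    have := ach_minus (F := F) d hd
    rwa [hF] at this
  have hcop : ∀ n N, 0 < N → Nat.Coprime (2 ^ n) (2 ^ N - 1) := fun n N hN =>
    Nat.Coprime.pow_left _ (Nat.coprime_two_left.2 (odd_two_pow_sub N hN))
  have key : ∀ a l, Odd a → Ach F (a + (2 ^ l - 1)) ((2 ^ a - 1) * (2 ^ 2 ^ l - 1)) :=
    fun a l ha => ach_add (hmin a ha.pos) (ach_W2 hF l) (coprime_mW2 ha)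
  have key2 : ∀ a l, Odd a → Ach F (1 + (a + (2 ^ l - 1))) (2 * ((2 ^ a - 1) * (2 ^ 2 ^ l - 1))) :=
    fun a l ha => ach_add (ach_of_zmod2 ach_2) (key a l ha)
      (Nat.Coprime.mul_right (by simpa using hcop 1 a ha.pos) (by simpa using hcop 1 (2 ^ l) (by positivity)))
  have hpos : 0 < 2 ^ (L - 1) := by positivity
  split_ifs with c1 c2 c3 c4 c5
  · have hu : Ach F m0 (2 ^ m0) := by
      interval_cases m0
      · simpa using ach_one F 0
      · exact ach_of_zmod2 ach_2
      · exact ach_of_zmod2 ach_4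
      · exact ach_of_zmod2 ach_8
    refine ach_cast (ach_add hu (ach_W2 hF L) (hcop _ _ (by positivity))) (by omega) rfl
  · have hev : Even (2 ^ (L - 1)) := by
      rw [Nat.even_pow]; refine ⟨even_two, ?_⟩
      rintro h; rw [h] at c2; omega
    exact ach_cast (key (2 ^ (L - 1) + m0) (L - 1) (hev.add_odd c3)) (by omega) rfl
  · have hev : Even (2 ^ (L - 1)) := by
      rw [Nat.even_pow]; refine ⟨even_two, ?_⟩
      rintro h; rw [h] at c2; omega
    have ho : Odd (2 ^ (L - 1) + m0 - 1) := by
      obtain ⟨r, hr⟩ := hev; obtain ⟨s, hs⟩ := Nat.not_odd_iff_even.1 c3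
      exact ⟨r + s - 1, by omega⟩
    exact ach_cast (key2 _ (L - 1) ho) (by omega) (by ring)
  · have hp := ach_plus (F := F) (2 ^ L) (by positivity)
    rw [hF] at hp
    refine ach_cast (ach_add hp (ach_W2 hF (L - 1)) ?_) (by omega) rfl
    refine eq_one_of_dvd_pm (i := L) even_two ?_ (Nat.gcd_dvd_left _ _) two_pos
    exact (Nat.gcd_dvd_right _ _).trans (two_pow_minus_dvd 2 _ _ (by omega))
  · exact ach_cast (key m0 L c5) (by omega) rfl
  · have ho : Odd (m0 - 1) := by
      obtain ⟨s, hs⟩ := Nat.not_odd_iff_even.1 c5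
      exact ⟨s - 1, by omega⟩
    exact ach_cast (key2 _ L ho) (by omega) (by ring)

theorem lower_bound [Finite F] [CharP F 2] {q : ℕ} (hF : Nat.card F = q) (hq : Even q) (hq0 : 0 < q)
    (m : ℕ) (hm : 1 ≤ m) : Ach F m (Mm m q) := by
  by_cases hq2 : q = 2
  · subst hq2; exact lower_two hF m hm
  rcases Nat.even_or_odd m with hme | hmo
  · by_cases hm2 : m = 2
    · subst hm2
      have : Mm 2 q = q ^ 2 + 1 := by
        rw [Mm, if_neg hq2, if_neg (by decide), if_pos rfl]
      rw [this, ← hF]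
      exact ach_plus 2 two_pos
    · have hm4 : 4 ≤ m := by obtain ⟨r, hr⟩ := hme; omega
      obtain ⟨L, hL, h1, h2, h3⟩ := Mm_even_spec m q hq2 hme hm4
      have hpL : 2 ^ L = 2 * 2 ^ (L - 1) := by rw [← pow_succ']; congr 1; omega
      have hpos : 0 < 2 ^ (L - 1) := by positivity
      have ho : Odd (m - 2 ^ L + 1) := by
        obtain ⟨r, hr⟩ := hme
        exact ⟨r - 2 ^ (L - 1), by omega⟩
      have hmin := ach_minus (F := F) _ ho.pos
      rw [hF] at hmin
      refine ach_cast (ach_add hmin (ach_W hF hq hq0 L) (coprime_mprod hq hq0 ho _)) (by omega) ?_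
      have hq1 : 0 < q - 1 := by obtain ⟨r, hr⟩ := hq; omega
      rw [h3, ← telescope q L hq0, ← mul_assoc, Nat.mul_div_cancel _ hq1]
  · obtain ⟨E, h1, h2⟩ := Mm_odd_spec m q hq2 hmo
    exact ach_cast (ach_prod hF hq hq0 E) h1 h2.symm

end lower


/-- the 2-adic valuation -/
def v2 (d : ℕ) : ℕ := padicValNat 2 d

theorem v2_spec {d : ℕ} (hd : 0 < d) : ∃ r, d = 2 ^ v2 d * (2 * r + 1) := by
  obtain ⟨k, m, ho, he⟩ := Nat.exists_eq_two_pow_mul_odd hd.ne'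
  have : v2 d = k := by
    unfold v2
    rw [he, padicValNat.mul (by positivity) (by have := ho.pos; omega), padicValNat.prime_pow,
      padicValNat.eq_zero_of_not_dvd (by have := ho.not_two_dvd_nat; exact this)]
    simp
  rw [this]
  obtain ⟨r, hr⟩ := ho
  exact ⟨r, by rw [← hr]; exact he⟩

theorem v2_dvd_iff {d : ℕ} (hd : 0 < d) (n : ℕ) : 2 ^ n ∣ d ↔ n ≤ v2 d :=
  padicValNat_dvd_iff_le hd.ne'

theorem v2_two_pow (n : ℕ) : v2 (2 ^ n) = n := padicValNat.prime_pow n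

theorem v2_eq {n r : ℕ} : v2 (2 ^ n * (2 * r + 1)) = n := by
  unfold v2
  rw [padicValNat.mul (by positivity) (by omega), padicValNat.prime_pow,
      padicValNat.eq_zero_of_not_dvd (by omega)]
  simp

theorem plus_dvd_plus (q : ℕ) {d : ℕ} (hd : 0 < d) : q ^ 2 ^ v2 d + 1 ∣ q ^ d + 1 := by
  obtain ⟨r, hr⟩ := v2_spec hd
  have h : q ^ d + 1 = (q ^ 2 ^ v2 d) ^ (2 * r + 1) + 1 ^ (2 * r + 1) := by
    rw [one_pow, ← pow_mul, ← hr]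
  rw [h]
  exact Odd.nat_add_dvd_pow_add_pow _ _ ⟨r, rfl⟩

theorem pow_add_one_le {q d : ℕ} (hd : 0 < d) (hq : 1 ≤ q) : q ^ d + 1 ≤ q ^ (d - 1) * (q + 1) := by
  obtain ⟨e, rfl⟩ : ∃ e, d = e + 1 := ⟨d - 1, by omega⟩
  have : 1 ≤ q ^ e := Nat.one_le_pow _ _ hq
  rw [Nat.add_sub_cancel, mul_add, pow_succ]
  omega

/-- merging a new factor sharing the divisor `r` -/
theorem merge {N r s : ℕ} (hN : 0 < N) (hs : 0 < s) (h1 : r ∣ N) (h2 : r ∣ s) :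
    ∃ N', 0 < N' ∧ N ∣ N' ∧ s ∣ N' ∧ N' * r = N * s := by
  obtain ⟨u, rfl⟩ := h1
  obtain ⟨w, rfl⟩ := h2
  have hr : 0 < r := Nat.pos_of_mul_pos_right hN
  have hu : 0 < u := Nat.pos_of_mul_pos_left hN
  have hw : 0 < w := Nat.pos_of_mul_pos_left hs
  exact ⟨r * u * w, by positivity, ⟨w, rfl⟩, ⟨u, by ring⟩, by ring⟩

theorem merge_plus {q N d X : ℕ} (hq : 2 ≤ q) (hd : 0 < d) (hN : 0 < N)
    (h1 : q ^ 2 ^ v2 d + 1 ∣ N) (hX : N * (q - 1) ≤ q ^ (X + 1)) :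
    ∃ N', 0 < N' ∧ N ∣ N' ∧ q ^ d + 1 ∣ N' ∧ N' * (q - 1) ≤ q ^ (X + d) := by
  obtain ⟨N', h2, h3, h4, h5⟩ := merge hN (by positivity) h1 (plus_dvd_plus q hd)
  refine ⟨N', h2, h3, h4, ?_⟩
  have h6 : q + 1 ≤ q ^ 2 ^ v2 d + 1 := by
    have : q ^ 1 ≤ q ^ 2 ^ v2 d := Nat.pow_le_pow_right (by omega) Nat.one_le_two_pow
    rw [pow_one] at this; omega
  have h7 := pow_add_one_le hd (show 1 ≤ q by omega)
  have h8 : N' * (q - 1) * (q + 1) ≤ q ^ (X + d) * (q + 1) := by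
    calc N' * (q - 1) * (q + 1) ≤ N' * (q - 1) * (q ^ 2 ^ v2 d + 1) := Nat.mul_le_mul_left _ h6
      _ = (N * (q - 1)) * (q ^ d + 1) := by rw [mul_right_comm, h5]; ring
      _ ≤ q ^ (X + 1) * (q ^ (d - 1) * (q + 1)) := Nat.mul_le_mul hX h7
      _ = q ^ (X + d) * (q + 1) := by
        rw [← mul_assoc, ← pow_add]; congr 2; omega
  exact Nat.le_of_mul_le_mul_right h8 (by omega)

theorem prod_plus_le {q : ℕ} (hq : 2 ≤ q) (D : Finset ℕ) (hD : ∀ d ∈ D, 0 < d)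
    (hinj : Set.InjOn v2 (D : Set ℕ)) : (∏ d ∈ D, (q ^ d + 1)) * (q - 1) ≤ q ^ (∑ d ∈ D, d + 1) := by
  -- q^d + 1 ≤ q^(d - 2^v) (q^(2^v) + 1)
  have hle : ∀ d ∈ D, 2 ^ v2 d ≤ d := fun d hd =>
    Nat.le_of_dvd (hD d hd) ((v2_dvd_iff (hD d hd) _).2 le_rfl)
  have h1 : ∀ d ∈ D, (q ^ d + 1) * q ^ 2 ^ v2 d ≤ q ^ d * (q ^ 2 ^ v2 d + 1) := by
    intro d hd
    have := Nat.pow_le_pow_right (show 0 < q by omega) (hle d hd)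
    nlinarith
  have h2 := Finset.prod_le_prod' h1
  rw [Finset.prod_mul_distrib, Finset.prod_mul_distrib, Finset.prod_pow_eq_pow_sum,
    Finset.prod_pow_eq_pow_sum] at h2
  rw [← Finset.prod_image (s := D) (g := v2) (f := fun i => q ^ 2 ^ i + 1)
    (fun a ha b hb h => hinj ha hb h),
    ← Finset.sum_image (s := D) (g := v2) (f := fun i => 2 ^ i)
    (fun a ha b hb h => hinj ha hb h)] at h2
  set E := D.image v2
  set S := ∑ d ∈ D, d
  -- for any E: prod * (q-1) ≤ q^(sum+1)
  have h3 : (∏ i ∈ E, (q ^ 2 ^ i + 1)) * (q - 1) ≤ q ^ (∑ i ∈ E, 2 ^ i + 1) := by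
    obtain ⟨n, hn⟩ : ∃ n, E ⊆ Finset.range n := ⟨E.sup id + 1, fun i hi => by
      have := Finset.le_sup (f := id) hi
      simp at this ⊢; omega⟩
    have h4 := telescope q n (by omega)
    have h5 : (∏ i ∈ Finset.range n \ E, q ^ 2 ^ i) ≤ ∏ i ∈ Finset.range n \ E, (q ^ 2 ^ i + 1) :=
      Finset.prod_le_prod' fun i _ => by omega
    rw [Finset.prod_pow_eq_pow_sum] at h5
    have h6 : (∏ i ∈ Finset.range n \ E, (q ^ 2 ^ i + 1)) * ∏ i ∈ E, (q ^ 2 ^ i + 1) =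
      ∏ i ∈ Finset.range n, (q ^ 2 ^ i + 1) := Finset.prod_sdiff hn
    have h7 : (∑ i ∈ Finset.range n \ E, 2 ^ i) + ∑ i ∈ E, 2 ^ i = 2 ^ n - 1 := by
      rw [Finset.sum_sdiff hn, sum_two_pow]
    have hn1 : 1 ≤ 2 ^ n := Nat.one_le_two_pow
    have h8 : q ^ (∑ i ∈ Finset.range n \ E, 2 ^ i) * ((∏ i ∈ E, (q ^ 2 ^ i + 1)) * (q - 1))
       ≤ q ^ (∑ i ∈ Finset.range n \ E, 2 ^ i) * q ^ (∑ i ∈ E, 2 ^ i + 1) := by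
      calc _ ≤ (∏ i ∈ Finset.range n \ E, (q ^ 2 ^ i + 1)) *
            ((∏ i ∈ E, (q ^ 2 ^ i + 1)) * (q - 1)) := Nat.mul_le_mul_right _ h5
        _ = q ^ 2 ^ n - 1 := by rw [← mul_assoc, h6, h4]
        _ ≤ q ^ 2 ^ n := Nat.sub_le _ _
        _ = _ := by rw [← pow_add]; congr 1; omega
    exact Nat.le_of_mul_le_mul_left h8 (by positivity)
  have h4 : (∏ d ∈ D, (q ^ d + 1)) * (q - 1) * q ^ (∑ i ∈ E, 2 ^ i) ≤
      q ^ (S + 1) * q ^ (∑ i ∈ E, 2 ^ i) := by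
    calc _ = (∏ d ∈ D, (q ^ d + 1)) * q ^ (∑ i ∈ E, 2 ^ i) * (q - 1) := by ring
      _ ≤ q ^ S * (∏ i ∈ E, (q ^ 2 ^ i + 1)) * (q - 1) := Nat.mul_le_mul_right _ h2
      _ = q ^ S * ((∏ i ∈ E, (q ^ 2 ^ i + 1)) * (q - 1)) := by ring
      _ ≤ q ^ S * q ^ (∑ i ∈ E, 2 ^ i + 1) := Nat.mul_le_mul_left _ h3
      _ = _ := by rw [← pow_add, ← pow_add]; congr 1; omega
  exact Nat.le_of_mul_le_mul_right h4 (by positivity)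

theorem base_D {q : ℕ} (hq : 2 ≤ q) (D : Finset ℕ) (hD : ∀ d ∈ D, 0 < d) :
    ∃ N, 0 < N ∧ (∀ d ∈ D, q ^ d + 1 ∣ N) ∧ N * (q - 1) ≤ q ^ (∑ d ∈ D, d + 1) ∧
      (¬ Set.InjOn v2 (D : Set ℕ) → N * (q - 1) ≤ q ^ (∑ d ∈ D, d)) := by
  induction D using Finset.strongInduction with
  | H D ih =>
    by_cases hinj : Set.InjOn v2 (D : Set ℕ)
    · exact ⟨∏ d ∈ D, (q ^ d + 1), Finset.prod_pos fun d _ => by positivity,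
        fun d hd => Finset.dvd_prod_of_mem _ hd, prod_plus_le hq D hD hinj, fun h => absurd hinj h⟩
    · have hinj' := hinj
      simp only [Set.InjOn] at hinj'
      push Not at hinj'
      obtain ⟨d, hd, e, he, hde, hne⟩ := hinj'
      obtain ⟨N, h1, h2, h3, -⟩ := ih (D.erase d) (Finset.erase_ssubset hd)
        (fun x hx => hD x (Finset.mem_of_mem_erase hx))
      have he' : e ∈ D.erase d := Finset.mem_erase.2 ⟨hne.symm, he⟩
      obtain ⟨N', k1, k2, k3, k4⟩ := merge_plus hq (hD d hd) h1
        (by rw [hde]; exact (plus_dvd_plus q (hD e he)).trans (h2 e he')) h3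
      rw [Finset.sum_erase_add _ _ hd] at k4
      refine ⟨N', k1, ?_, k4.trans (Nat.pow_le_pow_right (by omega) (by omega)), fun _ => k4⟩
      intro x hx
      by_cases hxd : x = d
      · rw [hxd]; exact k3
      · exact (h2 x (Finset.mem_erase.2 ⟨hxd, hx⟩)).trans k2

theorem prod_minus_le (q : ℕ) (A : Finset ℕ) : ∏ a ∈ A, (q ^ a - 1) ≤ q ^ ∑ a ∈ A, a := by
  rw [← Finset.prod_pow_eq_pow_sum]
  exact Finset.prod_le_prod' fun a _ => Nat.sub_le _ _

theorem prod_minus_pos {q : ℕ} (hq : 2 ≤ q) (A : Finset ℕ) (hA : ∀ a ∈ A, 0 < a) :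
    0 < ∏ a ∈ A, (q ^ a - 1) :=
  Finset.prod_pos fun a ha => by
    have := Nat.one_lt_pow (hA a ha).ne' (show 1 < q by omega)
    omega

theorem le_ucost (k : ℕ) : k ≤ ucost k := by
  unfold ucost
  split_ifs with h
  · omega
  · obtain ⟨j, rfl⟩ : ∃ j, k = j + 1 := ⟨k - 1, by omega⟩
    rw [Nat.add_sub_cancel, Nat.le_div_iff_mul_le two_pos]
    induction j with
    | zero => norm_num
    | succ n ih =>
      rcases n with _ | n
      · norm_num
      have h1 : 2 * 2 ^ n = 2 ^ (n + 1) := (pow_succ' 2 n).symm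
      have h2 : 2 * 2 ^ (n + 1) = 2 ^ (n + 1 + 1) := (pow_succ' 2 _).symm
      have := ih (by omega)
      have : 1 ≤ 2 ^ n := Nat.one_le_two_pow
      omega

theorem lt_ucost (k : ℕ) (hk : 4 ≤ k) : k + 1 ≤ ucost k := by
  unfold ucost
  rw [if_neg (by omega), Nat.le_div_iff_mul_le two_pos]
  obtain ⟨j, rfl⟩ : ∃ j, k = j + 4 := ⟨k - 4, by omega⟩
  rw [show j + 4 - 1 = j + 3 by omega, pow_add]
  have : j < 2 ^ j := Nat.lt_two_pow_self
  omega

/-- reduction to clean configurations -/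
theorem reduce {q m o : ℕ} (hq : q = 2 ∨ 4 ≤ q) {k : ℕ} {A D : Finset ℕ} (hA : ∀ a ∈ A, 0 < a)
    (hD : ∀ d ∈ D, 0 < d) (hs : ucost k + ∑ a ∈ A, a + ∑ d ∈ D, d ≤ m)
    (hN : ∀ N, 0 < N → (∀ a ∈ A, q ^ a - 1 ∣ N) → (∀ d ∈ D, q ^ d + 1 ∣ N) → o ≤ 2 ^ k * N) :
    o ≤ q ^ m ∨ (Set.InjOn v2 (D : Set ℕ) ∧ (∀ a ∈ A, ∀ d ∈ D, v2 a ≤ v2 d) ∧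
      k + ∑ a ∈ A, a + ∑ d ∈ D, d = m ∧ k ≤ 3 ∧ (4 ≤ q → k = 0 ∧ A.card ≤ 1) ∧
      o ≤ 2 ^ k * ((∏ a ∈ A, (q ^ a - 1)) * ∏ d ∈ D, (q ^ d + 1))) := by
  have hq2 : 2 ≤ q := by omega
  have hq1 : 1 ≤ q - 1 := by omega
  have hqq : q ≤ 2 * (q - 1) := by omega
  by_cases hgood : o ≤ q ^ m
  · exact Or.inl hgood
  right
  have hkq : 2 ^ k ≤ q ^ ucost k :=
    (Nat.pow_le_pow_left hq2 k).trans (Nat.pow_le_pow_right (by omega) (le_ucost k))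
  have hAp := prod_minus_pos hq2 A hA
  have hAl := prod_minus_le q A
  -- finishing: a common multiple N with 2^k N (q-1) ≤ q^m (q-1) is impossible
  have fin : ∀ N, 0 < N → (∀ a ∈ A, q ^ a - 1 ∣ N) → (∀ d ∈ D, q ^ d + 1 ∣ N) →
      ¬ (2 ^ k * (N * (q - 1)) ≤ q ^ m * (q - 1)) := by
    intro N h1 h2 h3 h4
    rw [← mul_assoc] at h4
    exact hgood ((hN N h1 h2 h3).trans (Nat.le_of_mul_le_mul_right h4 hq1))
  have fin' : ∀ N, 0 < N → (∀ a ∈ A, q ^ a - 1 ∣ N) → (∀ d ∈ D, q ^ d + 1 ∣ N) →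
      ¬ (N * (q - 1) ≤ q ^ (∑ a ∈ A, a + ∑ d ∈ D, d)) := by
    intro N h1 h2 h3 h4
    refine fin N h1 h2 h3 ?_
    calc 2 ^ k * (N * (q - 1)) ≤ q ^ ucost k * q ^ (∑ a ∈ A, a + ∑ d ∈ D, d) :=
          Nat.mul_le_mul hkq h4
      _ = q ^ (ucost k + ∑ a ∈ A, a + ∑ d ∈ D, d) := by rw [← pow_add, add_assoc]
      _ ≤ q ^ m := Nat.pow_le_pow_right (by omega) hs
      _ ≤ q ^ m * (q - 1) := Nat.le_mul_of_pos_right _ hq1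
  obtain ⟨ND, d1, d2, d3, d4⟩ := base_D hq2 D hD
  have hNall : (∀ a ∈ A, q ^ a - 1 ∣ (∏ a ∈ A, (q ^ a - 1)) * ND) := fun a ha =>
    (Finset.dvd_prod_of_mem (fun a => q ^ a - 1) ha).mul_right _
  have hNall2 : (∀ d ∈ D, q ^ d + 1 ∣ (∏ a ∈ A, (q ^ a - 1)) * ND) := fun d hd =>
    (d2 d hd).mul_left _
  have hNpos : 0 < (∏ a ∈ A, (q ^ a - 1)) * ND := by positivity
  have hinj : Set.InjOn v2 (D : Set ℕ) := by
    by_contra hcon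
    refine fin' _ hNpos hNall hNall2 ?_
    rw [mul_assoc, pow_add]
    exact Nat.mul_le_mul hAl (d4 hcon)
  have hbase : (∏ a ∈ A, (q ^ a - 1)) * ND * (q - 1) ≤ q ^ (∑ a ∈ A, a + ∑ d ∈ D, d + 1) := by
    rw [mul_assoc, add_assoc, pow_add]
    exact Nat.mul_le_mul hAl d3
  have hslack : ucost k + ∑ a ∈ A, a + ∑ d ∈ D, d = m := by
    by_contra hcon
    refine fin _ hNpos hNall hNall2 ?_
    calc _ ≤ q ^ ucost k * q ^ (∑ a ∈ A, a + ∑ d ∈ D, d + 1) := Nat.mul_le_mul hkq hbase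
      _ = q ^ (ucost k + (∑ a ∈ A, a + ∑ d ∈ D, d + 1)) := by rw [← pow_add]
      _ ≤ q ^ m := Nat.pow_le_pow_right (by omega) (by omega)
      _ ≤ q ^ m * (q - 1) := Nat.le_mul_of_pos_right _ hq1
  have hk : ¬ (2 ^ k * 2 ≤ q ^ ucost k) := by
    intro hcon
    refine fin _ hNpos hNall hNall2 ?_
    calc _ ≤ 2 ^ k * q ^ (∑ a ∈ A, a + ∑ d ∈ D, d + 1) := Nat.mul_le_mul_left _ hbase
      _ = 2 ^ k * q * q ^ (∑ a ∈ A, a + ∑ d ∈ D, d) := by ring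
      _ ≤ 2 ^ k * (2 * (q - 1)) * q ^ (∑ a ∈ A, a + ∑ d ∈ D, d) := by gcongr
      _ = (2 ^ k * 2) * q ^ (∑ a ∈ A, a + ∑ d ∈ D, d) * (q - 1) := by ring
      _ ≤ q ^ ucost k * q ^ (∑ a ∈ A, a + ∑ d ∈ D, d) * (q - 1) := by gcongr
      _ = q ^ m * (q - 1) := by rw [← pow_add, ← add_assoc, hslack]
  have hk3 : k ≤ 3 := by
    by_contra hcon
    apply hk
    rw [← pow_succ]
    exact (Nat.pow_le_pow_left hq2 _).trans (Nat.pow_le_pow_right (by omega) (lt_ucost k (by omega)))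
  have huk : ucost k = k := by interval_cases k <;> rfl
  refine ⟨hinj, ?_, by rw [← huk]; exact hslack, hk3, ?_, ?_⟩
  · intro a ha d hd
    by_contra hcon
    push Not at hcon
    obtain ⟨N1, e1, e2, e3, -⟩ := base_D hq2 (D.erase d) (fun x hx => hD x (Finset.mem_of_mem_erase hx))
    have hr : q ^ 2 ^ v2 d + 1 ∣ (∏ a ∈ A, (q ^ a - 1)) * N1 := by
      refine Dvd.dvd.mul_right ?_ _
      refine (plus_dvd_minus q (v2 d)).trans (Dvd.dvd.trans ?_ (Finset.dvd_prod_of_mem _ ha))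
      exact Nat.pow_sub_one_dvd_pow_sub_one q ((v2_dvd_iff (hA a ha) _).2 hcon)
    obtain ⟨N', k1, k2, k3, k4⟩ := merge_plus (X := ∑ a ∈ A, a + ∑ d ∈ D.erase d, d)
      hq2 (hD d hd) (by positivity) hr
      (by rw [mul_assoc, add_assoc, pow_add]; exact Nat.mul_le_mul hAl e3)
    rw [add_assoc, Finset.sum_erase_add _ _ hd] at k4
    refine fin' N' k1 ?_ ?_ k4
    · intro b hb
      exact ((Finset.dvd_prod_of_mem (fun a => q ^ a - 1) hb).mul_right _).trans k2
    · intro x hx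
      by_cases hxd : x = d
      · rw [hxd]; exact k3
      · exact ((e2 x (Finset.mem_erase.2 ⟨hxd, hx⟩)).mul_left _).trans k2
  · intro hq4
    refine ⟨?_, ?_⟩
    · by_contra hk0
      apply hk
      rw [huk]
      calc 2 ^ k * 2 ≤ 2 ^ k * 2 ^ k := Nat.mul_le_mul_left _ (by
              simpa using Nat.pow_le_pow_right two_pos (show 1 ≤ k by omega))
        _ = 4 ^ k := by rw [← mul_pow]; norm_num
        _ ≤ q ^ k := Nat.pow_le_pow_left hq4 k
    · by_contra hcard
      push Not at hcard
      obtain ⟨a, ha, b, hb, hne⟩ := Finset.one_lt_card.1 hcard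
      have hApos' := prod_minus_pos hq2 (A.erase a) (fun x hx => hA x (Finset.mem_of_mem_erase hx))
      have hb' : b ∈ A.erase a := Finset.mem_erase.2 ⟨hne.symm, hb⟩
      have hdv : ∀ b, q - 1 ∣ q ^ b - 1 := fun b => by
        simpa using Nat.pow_sub_one_dvd_pow_sub_one q (one_dvd b)
      have hpa : 0 < q ^ a - 1 := by
        have := Nat.one_lt_pow (hA a ha).ne' (show 1 < q by omega)
        omega
      obtain ⟨N', k1, k2, k3, k4⟩ := merge (N := (∏ a ∈ A.erase a, (q ^ a - 1)) * ND) (r := q - 1)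
        (s := q ^ a - 1) (by positivity) hpa
        (((hdv b).trans (Finset.dvd_prod_of_mem (fun a => q ^ a - 1) hb')).mul_right _) (hdv a)
      refine fin N' k1 ?_ ?_ ?_
      · intro x hx
        by_cases hxd : x = a
        · rw [hxd]; exact k3
        · exact ((Finset.dvd_prod_of_mem (fun a => q ^ a - 1)
            (Finset.mem_erase.2 ⟨hxd, hx⟩)).mul_right _).trans k2
      · intro x hx
        exact ((d2 x hx).mul_left _).trans k2
      · have e1 : N' * (q - 1) = (∏ a ∈ A, (q ^ a - 1)) * ND := by
          rw [k4, mul_right_comm, Finset.prod_erase_mul _ _ ha]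
        rw [e1]
        have e2 : 2 ^ k * ((∏ a ∈ A, (q ^ a - 1)) * ND) * (q - 1) ≤ q ^ m * (q - 1) * (q - 1) := by
          calc _ = 2 ^ k * ((∏ a ∈ A, (q ^ a - 1)) * ND * (q - 1)) := by ring
            _ ≤ q ^ ucost k * q ^ (∑ a ∈ A, a + ∑ d ∈ D, d + 1) := Nat.mul_le_mul hkq hbase
            _ = q ^ m * q := by rw [← pow_add, ← hslack, ← pow_succ]; congr 1; omega
            _ ≤ q ^ m * ((q - 1) * (q - 1)) := by
              refine Nat.mul_le_mul_left _ ?_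
              calc q ≤ 2 * (q - 1) := hqq
                _ ≤ _ := Nat.mul_le_mul_right _ (by omega)
            _ = _ := by ring
        exact Nat.le_of_mul_le_mul_right e2 hq1
  · exact hN _ (Nat.mul_pos hAp (Finset.prod_pos fun d _ => by positivity))
      (fun a ha => (Finset.dvd_prod_of_mem (fun a => q ^ a - 1) ha).mul_right _)
      (fun d hd => (Finset.dvd_prod_of_mem (fun d => q ^ d + 1) hd).mul_left _)


section real_lemmas
variable {x : ℝ}

theorem telescope_real (x : ℝ) (n : ℕ) :
    (∏ i ∈ Finset.range n, (1 + x ^ 2 ^ i)) * (1 - x) = 1 - x ^ 2 ^ n := by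
  induction n with
  | zero => simp
  | succ n ih =>
    rw [Finset.prod_range_succ, mul_right_comm, ih, pow_succ 2, pow_mul]
    ring

theorem one_le_prod_real (S : Finset ℕ) (f : ℕ → ℝ) (h : ∀ i ∈ S, 1 ≤ f i) : 1 ≤ ∏ i ∈ S, f i := by
  have := Finset.prod_le_prod (s := S) (f := fun _ => (1 : ℝ)) (g := f) (fun _ _ => zero_le_one) h
  simpa using this

theorem pow_le_half {x : ℝ} (h0 : 0 < x) (h1 : x ≤ 1 / 2) {n : ℕ} (hn : 0 < n) : x ^ n ≤ 1 / 2 := by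
  calc x ^ n ≤ x ^ 1 := pow_le_pow_of_le_one h0.le (by linarith) hn
    _ ≤ 1 / 2 := by simpa using h1

theorem lemma_P (h0 : 0 < x) (h1 : x ≤ 1 / 2) (t : ℕ) (D : Finset ℕ) (hD : ∀ d ∈ D, 0 < d)
    (hinj : Set.InjOn v2 (D : Set ℕ)) (ht : ∀ d ∈ D, t ≤ v2 d) :
    (∏ d ∈ D, (1 + x ^ d)) * (1 - x ^ 2 ^ t) ≤ 1 := by
  have hle : ∀ d ∈ D, 2 ^ v2 d ≤ d := fun d hd =>
    Nat.le_of_dvd (hD d hd) ((v2_dvd_iff (hD d hd) _).2 le_rfl)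
  set y := x ^ 2 ^ t with hy
  have hy0 : 0 < y := by positivity
  have hy1 : y ≤ 1 / 2 := pow_le_half h0 h1 (by positivity)
  have hA : ∏ d ∈ D, (1 + x ^ d) ≤ ∏ d ∈ D, (1 + y ^ 2 ^ (v2 d - t)) := by
    refine Finset.prod_le_prod (fun d _ => by positivity) fun d hd => ?_
    rw [hy, ← pow_mul, ← pow_add, show t + (v2 d - t) = v2 d by have := ht d hd; omega]
    have := pow_le_pow_of_le_one h0.le (by linarith) (hle d hd)
    linarith
  rw [← Finset.prod_image (s := D) (g := fun d => v2 d - t) (f := fun i => 1 + y ^ 2 ^ i)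
    (fun a ha b hb h => hinj ha hb (by
      have := ht a ha; have := ht b hb; simp only at h; omega))] at hA
  set E := D.image fun d => v2 d - t
  obtain ⟨n, hn⟩ : ∃ n, E ⊆ Finset.range n := ⟨E.sup id + 1, fun i hi => by
      have := Finset.le_sup (f := id) hi
      simp at this ⊢; omega⟩
  have hB : ∏ i ∈ E, (1 + y ^ 2 ^ i) ≤ ∏ i ∈ Finset.range n, (1 + y ^ 2 ^ i) :=
    Finset.prod_le_prod_of_subset_of_one_le (R := ℝ) hn (fun i _ => by positivity)
      (fun i _ _ => by have : 0 ≤ y ^ 2 ^ i := by positivity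
                       linarith)
  calc _ ≤ (∏ i ∈ Finset.range n, (1 + y ^ 2 ^ i)) * (1 - y) :=
        mul_le_mul_of_nonneg_right (hA.trans hB) (by linarith)
    _ = 1 - y ^ 2 ^ n := telescope_real y n
    _ ≤ 1 := by have : 0 ≤ y ^ 2 ^ n := by positivity
                linarith

theorem lemma_R (h0 : 0 < x) (h1 : x ≤ 1 / 2) (t : ℕ) (D : Finset ℕ) (hD : ∀ d ∈ D, 0 < d)
    (hinj : Set.InjOn v2 (D : Set ℕ)) (ht : ∀ d ∈ D, t ≤ v2 d) (hn : 2 ^ t ∉ D) :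
    (∏ d ∈ D, (1 + x ^ d)) * (1 - (x ^ 2 ^ t) ^ 2) ≤ 1 + (x ^ 2 ^ t) ^ 3 := by
  set y := x ^ 2 ^ t with hy
  have hy0 : 0 < y := by positivity
  have hy1 : y ≤ 1 / 2 := pow_le_half h0 h1 (by positivity)
  have hys : y ^ 2 = x ^ 2 ^ (t + 1) := by rw [hy, ← pow_mul, pow_succ]
  by_cases hex : ∃ d ∈ D, v2 d = t
  · obtain ⟨d, hd, hdt⟩ := hex
    have hP := lemma_P h0 h1 (t + 1) (D.erase d) (fun e he => hD e (Finset.mem_of_mem_erase he))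
      (hinj.mono (by simp)) (by
        intro e he
        have h2 := Finset.mem_of_mem_erase he
        have h3 := ht e h2
        have h4 : v2 e ≠ t := fun h => (Finset.ne_of_mem_erase he) (hinj h2 hd (h.trans hdt.symm))
        omega)
    rw [← hys] at hP
    obtain ⟨r, hr⟩ := v2_spec (hD d hd)
    rw [hdt] at hr
    have hr0 : r ≠ 0 := by
      rintro rfl
      apply hn
      simp at hr
      rwa [← hr]
    have hxd : x ^ d ≤ y ^ 3 := by
      rw [hr, pow_mul, ← hy]
      exact pow_le_pow_of_le_one hy0.le (by linarith) (by omega)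
    rw [← Finset.mul_prod_erase _ _ hd, mul_assoc]
    calc _ ≤ (1 + x ^ d) * 1 := mul_le_mul_of_nonneg_left hP (by positivity)
      _ ≤ _ := by linarith
  · push Not at hex
    have hP := lemma_P h0 h1 (t + 1) D hD hinj (fun e he => by
      have := ht e he; have := hex e he; omega)
    rw [← hys] at hP
    have : 0 < y ^ 3 := by positivity
    linarith

theorem decomp (D : Finset ℕ) (hD : ∀ d ∈ D, 0 < d) (hinj : Set.InjOn v2 (D : Set ℕ)) :
    ∃ t, ∃ D' ⊆ D, (∀ i < t, 2 ^ i ∈ D) ∧ (∀ d ∈ D', t ≤ v2 d) ∧ 2 ^ t ∉ D' ∧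
      ∑ d ∈ D, d = 2 ^ t - 1 + ∑ d ∈ D', d ∧
      ∀ f : ℕ → ℝ, ∏ d ∈ D, f d = (∏ i ∈ Finset.range t, f (2 ^ i)) * ∏ d ∈ D', f d := by
  have hex : ∃ t, 2 ^ t ∉ D := by
    by_contra h
    push Not at h
    have h1 := Finset.single_le_sum (f := fun d => d) (fun _ _ => Nat.zero_le _) (h (∑ d ∈ D, d))
    have h2 : ∑ d ∈ D, d < 2 ^ ∑ d ∈ D, d := Nat.lt_two_pow_self
    omega
  classical
  set t := Nat.find hex with ht
  have ht1 : 2 ^ t ∉ D := Nat.find_spec hex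
  have ht2 : ∀ i < t, 2 ^ i ∈ D := fun i hi => by
    by_contra hc; exact Nat.find_min hex hi hc
  set I := (Finset.range t).image (fun i => 2 ^ i) with hI
  have hID : I ⊆ D := by
    intro d hd
    obtain ⟨i, hi, rfl⟩ := Finset.mem_image.1 hd
    exact ht2 i (Finset.mem_range.1 hi)
  have hinj2 : Set.InjOn (fun i => 2 ^ i) (Finset.range t : Set ℕ) :=
    fun a _ b _ h => Nat.pow_right_injective le_rfl h
  refine ⟨t, D \ I, Finset.sdiff_subset, ht2, ?_, fun h => ht1 (Finset.mem_sdiff.1 h).1, ?_, ?_⟩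
  · intro d hd
    by_contra hlt
    push Not at hlt
    obtain ⟨hd1, hd2⟩ := Finset.mem_sdiff.1 hd
    have := hinj hd1 (ht2 _ hlt) (v2_two_pow _).symm
    exact hd2 (Finset.mem_image.2 ⟨v2 d, Finset.mem_range.2 hlt, this.symm⟩)
  · rw [← Finset.sum_sdiff hID, hI, Finset.sum_image hinj2, sum_two_pow]; omega
  · intro f
    rw [← Finset.prod_sdiff hID, hI, Finset.prod_image hinj2, mul_comm]

theorem lemma_Q (h0 : 0 < x) (h1 : x ≤ 1 / 2) (D D' : Finset ℕ) (hD : ∀ d ∈ D, 0 < d)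
    (hinj : Set.InjOn v2 (D : Set ℕ)) (t : ℕ) (hsub : D' ⊆ D) (ht : ∀ d ∈ D', t ≤ v2 d)
    (hn : 2 ^ t ∉ D')
    (hp : ∀ f : ℕ → ℝ, ∏ d ∈ D, f d = (∏ i ∈ Finset.range t, f (2 ^ i)) * ∏ d ∈ D', f d) :
    (∏ d ∈ D, (1 + x ^ d)) * (1 - x) ≤ 1 - x ^ 2 ^ t + (x ^ 2 ^ t) ^ 2 := by
  have hR := lemma_R h0 h1 t D' (fun d hd => hD d (hsub hd)) (hinj.mono (by exact_mod_cast hsub)) ht hn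
  rw [hp, mul_right_comm, telescope_real x t]
  set w := x ^ 2 ^ t with hw
  have hw0 : 0 < w := by positivity
  have hw1 : w ≤ 1 / 2 := pow_le_half h0 h1 (by positivity)
  have h3 : (1 - w) * (∏ d ∈ D', (1 + x ^ d)) * (1 + w) ≤ (1 - w + w ^ 2) * (1 + w) := by nlinarith
  exact le_of_mul_le_mul_right h3 (by linarith)

theorem sum_val (D : Finset ℕ) (hD : ∀ d ∈ D, 0 < d) (hinj : Set.InjOn v2 (D : Set ℕ))
    (d₀ : ℕ) (hd₀ : d₀ ∈ D) (hmin : ∀ d ∈ D, v2 d₀ ≤ v2 d) : v2 (∑ d ∈ D, d) = v2 d₀ := by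
  obtain ⟨r, hr⟩ := v2_spec (hD _ hd₀)
  have hdv : 2 ^ (v2 d₀ + 1) ∣ ∑ d ∈ D.erase d₀, d := by
    refine Finset.dvd_sum fun d hd => ?_
    have h2 := Finset.mem_of_mem_erase hd
    rw [v2_dvd_iff (hD d h2)]
    have h3 := hmin d h2
    have h4 : v2 d ≠ v2 d₀ := fun h => (Finset.ne_of_mem_erase hd) (hinj h2 hd₀ h)
    omega
  obtain ⟨s, hs⟩ := hdv
  have : ∑ d ∈ D, d = 2 ^ v2 d₀ * (2 * (r + s) + 1) := by
    rw [← Finset.add_sum_erase _ _ hd₀, hs]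
    have : 2 ^ (v2 d₀ + 1) * s = 2 ^ v2 d₀ * (2 * s) := by ring
    rw [this]
    generalize 2 ^ v2 d₀ = p at *
    rw [hr]
    ring
  rw [this, v2_eq]

theorem lemma_A (h0 : 0 < x) (h1 : x ≤ 1 / 2) (D : Finset ℕ) (hD : ∀ d ∈ D, 0 < d)
    (hinj : Set.InjOn v2 (D : Set ℕ)) (E : Finset ℕ) (hE : ∀ e ∈ E, 2 ^ v2 e = e)
    (hs : ∑ d ∈ D, d = ∑ e ∈ E, e) : ∏ d ∈ D, (1 + x ^ d) ≤ ∏ e ∈ E, (1 + x ^ e) := by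
  induction D using Finset.strongInduction generalizing E with
  | H D ih =>
    have hEpos : ∀ e ∈ E, 0 < e := fun e he => by rw [← hE e he]; positivity
    have hEinj : Set.InjOn v2 (E : Set ℕ) := fun a ha b hb h => by
      rw [← hE a ha, ← hE b hb, h]
    have hE1 : ∀ S : Finset ℕ, 1 ≤ ∏ e ∈ S, (1 + x ^ e) := fun S =>
      one_le_prod_real _ _ fun e _ => by
        have : 0 < x ^ e := by positivity
        linarith
    rcases D.eq_empty_or_nonempty with rfl | hne
    · simpa using hE1 E
    obtain ⟨d, hd, hmin⟩ := Finset.exists_min_image D v2 hne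
    have hEne : E.Nonempty := by
      by_contra hcon
      rw [Finset.not_nonempty_iff_eq_empty] at hcon
      rw [hcon, Finset.sum_empty] at hs
      have := (Finset.sum_eq_zero_iff.1 hs) d hd
      exact (hD d hd).ne' this
    obtain ⟨e, he, hemin⟩ := Finset.exists_min_image E v2 hEne
    have hv : v2 d = v2 e := by
      rw [← sum_val D hD hinj d hd hmin, ← sum_val E hEpos hEinj e he hemin, hs]
    by_cases hde : d = e
    · subst hde
      have := ih (D.erase d) (Finset.erase_ssubset hd) (fun e he => hD e (Finset.mem_of_mem_erase he))
        (hinj.mono (by simp)) (E.erase d)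
        (fun e he => hE e (Finset.mem_of_mem_erase he)) (by
          rw [← Finset.add_sum_erase _ _ hd, ← Finset.add_sum_erase _ _ he] at hs
          omega)
      rw [← Finset.mul_prod_erase _ _ hd, ← Finset.mul_prod_erase _ _ he]
      exact mul_le_mul_of_nonneg_left this (by positivity)
    · have hn : 2 ^ v2 d ∉ D := fun h => by
        have h2 := hinj h hd (v2_two_pow _)
        apply hde
        rw [← h2, hv, hE e he]
      have hR := lemma_R h0 h1 (v2 d) D hD hinj hmin hn
      rw [hv, hE e he] at hR
      set y := x ^ e with hy
      have hy0 : 0 < y := by positivity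
      have hy1 : y ≤ 1 / 2 := pow_le_half h0 h1 (hEpos e he)
      have h3 : 1 + y ≤ ∏ e ∈ E, (1 + x ^ e) := by
        rw [← Finset.mul_prod_erase _ _ he, ← hy]
        exact le_mul_of_one_le_right (by positivity) (hE1 _)
      refine le_trans ?_ h3
      have h4 : 0 < 1 - y ^ 2 := by nlinarith
      refine le_of_mul_le_mul_right (hR.trans ?_) h4
      nlinarith [mul_pos hy0 hy0]
end real_lemmas


theorem v2_pos_of_even {d : ℕ} (hd : 0 < d) (he : Even d) : 1 ≤ v2 d := by
  rw [← v2_dvd_iff hd, pow_one]; exact he.two_dvd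

theorem v2_odd {d : ℕ} (hd : 0 < d) (ho : Odd d) : v2 d = 0 := by
  by_contra h
  have : 1 ≤ v2 d := by omega
  rw [← v2_dvd_iff hd, pow_one] at this
  exact ho.not_two_dvd_nat this

theorem odd_of_v2 {d : ℕ} (hd : 0 < d) (ho : v2 d = 0) : Odd d := by
  by_contra h
  have := v2_pos_of_even hd (Nat.not_odd_iff_even.1 h)
  omega

/-- an odd element in a `v2`-injective set makes the sum odd -/
theorem sum_odd (D : Finset ℕ) (hD : ∀ d ∈ D, 0 < d) (hinj : Set.InjOn v2 (D : Set ℕ))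
    {d : ℕ} (hd : d ∈ D) (ho : v2 d = 0) : Odd (∑ d ∈ D, d) := by
  have h1 := sum_val D hD hinj d hd (fun e _ => by omega)
  have h2 : 0 < ∑ d ∈ D, d :=
    (hD d hd).trans_le (Finset.single_le_sum (f := fun d => d) (fun _ _ => Nat.zero_le _) hd)
  exact odd_of_v2 h2 (by omega)

theorem prodA_nonneg {x : ℝ} (h0 : 0 < x) (h1 : x ≤ 1 / 2) (A : Finset ℕ) :
    0 ≤ ∏ a ∈ A, (1 - x ^ a) :=
  Finset.prod_nonneg fun a _ => by
    have := pow_le_one₀ h0.le (by linarith : x ≤ 1) (n := a); linarith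

theorem prodA_le_one {x : ℝ} (h0 : 0 < x) (h1 : x ≤ 1 / 2) (A : Finset ℕ) :
    ∏ a ∈ A, (1 - x ^ a) ≤ 1 :=
  Finset.prod_le_one (fun a _ => by
    have := pow_le_one₀ h0.le (by linarith : x ≤ 1) (n := a); linarith)
    (fun a _ => by have : 0 < x ^ a := by positivity
                   linarith)

theorem prodA_le {x : ℝ} (h0 : 0 < x) (h1 : x ≤ 1 / 2) (A : Finset ℕ) {a : ℕ} (ha : a ∈ A) :
    ∏ a ∈ A, (1 - x ^ a) ≤ 1 - x ^ a := by
  rw [← Finset.mul_prod_erase _ _ ha]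
  exact mul_le_of_le_one_right (by
    have := pow_le_one₀ h0.le (by linarith : x ≤ 1) (n := a); linarith) (prodA_le_one h0 h1 _)

theorem cast_pairprod {q : ℕ} (hq : 1 ≤ q) (A D : Finset ℕ) :
    (((∏ a ∈ A, (q ^ a - 1)) * ∏ d ∈ D, (q ^ d + 1) : ℕ) : ℝ) =
      (q : ℝ) ^ (∑ a ∈ A, a + ∑ d ∈ D, d) *
        ((∏ a ∈ A, (1 - ((q : ℝ)⁻¹) ^ a)) * ∏ d ∈ D, (1 + ((q : ℝ)⁻¹) ^ d)) := by
  have hq0 : (q : ℝ) ≠ 0 := by positivity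
  rw [pow_add, ← Finset.prod_pow_eq_pow_sum, ← Finset.prod_pow_eq_pow_sum]
  rw [mul_mul_mul_comm, ← Finset.prod_mul_distrib, ← Finset.prod_mul_distrib]
  push_cast
  congr 1
  · refine Finset.prod_congr rfl fun a _ => ?_
    rw [Nat.cast_sub (Nat.one_le_pow _ _ hq)]
    push_cast
    rw [mul_sub, ← mul_pow, mul_inv_cancel₀ hq0]; simp
  · refine Finset.prod_congr rfl fun a _ => ?_
    rw [mul_add, ← mul_pow, mul_inv_cancel₀ hq0]; simp

theorem real_odd {x : ℝ} (h0 : 0 < x) (h1 : x ≤ 1 / 4) (m : ℕ) (hm : Odd m) (A D : Finset ℕ)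
    (hA : ∀ a ∈ A, 0 < a) (hD : ∀ d ∈ D, 0 < d) (hinj : Set.InjOn v2 (D : Set ℕ))
    (hva : ∀ a ∈ A, ∀ d ∈ D, v2 a ≤ v2 d) (hsum : ∑ a ∈ A, a + ∑ d ∈ D, d = m)
    (hcard : A.card ≤ 1) (E : Finset ℕ) (hE : ∑ i ∈ E, 2 ^ i = m) :
    (∏ a ∈ A, (1 - x ^ a)) * ∏ d ∈ D, (1 + x ^ d) ≤ ∏ i ∈ E, (1 + x ^ 2 ^ i) := by
  have h2 : x ≤ 1 / 2 := by linarith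
  rcases Nat.le_one_iff_eq_zero_or_eq_one.1 hcard with hc | hc
  · rw [Finset.card_eq_zero] at hc
    subst hc
    have hinj2 : Set.InjOn (fun i => 2 ^ i) (E : Set ℕ) :=
      fun a _ b _ h => Nat.pow_right_injective le_rfl h
    have := lemma_A h0 h2 D hD hinj (E.image (fun i => 2 ^ i)) (by
      intro e he
      obtain ⟨i, -, rfl⟩ := Finset.mem_image.1 he
      rw [v2_two_pow]) (by rw [Finset.sum_image hinj2, hE]; simpa using hsum)
    rw [Finset.prod_image hinj2] at this
    simpa using this
  · obtain ⟨a, rfl⟩ := Finset.card_eq_one.1 hc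
    simp only [Finset.mem_singleton, forall_eq] at hA hva
    rw [Finset.sum_singleton] at hsum
    rw [Finset.prod_singleton]
    have hev : ∀ d ∈ D, 1 ≤ v2 d := by
      intro d hd
      by_contra hcon
      have hd0 : v2 d = 0 := by omega
      have ha0 : v2 a = 0 := by have := hva d hd; omega
      have h3 := sum_odd D hD hinj hd hd0
      have h4 := odd_of_v2 hA ha0
      have := h4.add_odd h3
      rw [hsum] at this
      exact (Nat.not_odd_iff_even.2 this) hm
    have hP := lemma_P h0 h2 1 D hD hinj hev
    have h0E : 0 ∈ E := by
      by_contra hcon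
      have : 2 ∣ ∑ i ∈ E, 2 ^ i := Finset.dvd_sum fun i hi =>
        dvd_pow_self 2 (fun h => hcon (h ▸ hi))
      rw [hE] at this
      exact hm.not_two_dvd_nat this
    have hEle : 1 + x ≤ ∏ i ∈ E, (1 + x ^ 2 ^ i) := by
      rw [← Finset.mul_prod_erase _ _ h0E]
      simp only [pow_zero, pow_one]
      refine le_mul_of_one_le_right (by positivity) (one_le_prod_real _ _ fun i _ => ?_)
      have : 0 < x ^ 2 ^ i := by positivity
      linarith
    refine le_trans ?_ hEle
    have hpos : 0 ≤ ∏ d ∈ D, (1 + x ^ d) := Finset.prod_nonneg fun d _ => by positivity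
    have hxa : 0 < x ^ a := by positivity
    have h5 : (1 - x ^ a) * ∏ d ∈ D, (1 + x ^ d) ≤ ∏ d ∈ D, (1 + x ^ d) :=
      mul_le_of_le_one_left hpos (by linarith)
    refine h5.trans ?_
    rw [pow_one] at hP
    have h6 : 0 < 1 - x ^ 2 := by nlinarith
    refine le_of_mul_le_mul_right (hP.trans ?_) h6
    nlinarith [mul_pos h0 h0]

theorem real_m2 {x : ℝ} (h0 : 0 < x) (h1 : x ≤ 1 / 4) (A D : Finset ℕ)
    (hA : ∀ a ∈ A, 0 < a) (hD : ∀ d ∈ D, 0 < d) (hinj : Set.InjOn v2 (D : Set ℕ))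
    (hsum : ∑ a ∈ A, a + ∑ d ∈ D, d = 2)
    (hcard : A.card ≤ 1) :
    (∏ a ∈ A, (1 - x ^ a)) * ∏ d ∈ D, (1 + x ^ d) ≤ 1 + x ^ 2 := by
  have h2 : x ≤ 1 / 2 := by linarith
  rcases Nat.le_one_iff_eq_zero_or_eq_one.1 hcard with hc | hc
  · rw [Finset.card_eq_zero] at hc
    subst hc
    have := lemma_A h0 h2 D hD hinj {2} (by
      have := v2_two_pow 1
      simp at this ⊢; rw [this]; norm_num) (by simpa using hsum)
    simpa using this
  · obtain ⟨a, rfl⟩ := Finset.card_eq_one.1 hc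
    simp only [Finset.mem_singleton, forall_eq] at hA
    rw [Finset.sum_singleton] at hsum
    rw [Finset.prod_singleton]
    have ha2 : a ≤ 2 := by omega
    interval_cases a
    · have := lemma_A h0 h2 D hD hinj {1} (by
        have := v2_two_pow 0
        simp at this ⊢; rw [this]) (by simp; omega)
      simp at this ⊢
      nlinarith
    · have := lemma_A h0 h2 D hD hinj ∅ (by simp) (by simp at hsum ⊢; exact hsum)
      simp at this ⊢
      have h5 : (1 - x ^ 2) * ∏ d ∈ D, (1 + x ^ d) ≤ (1 - x ^ 2) * 1 :=
        mul_le_mul_of_nonneg_left this (by nlinarith)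
      nlinarith

theorem ge_two_mul {d L : ℕ} (hd : 0 < d) (hv : L ≤ v2 d) (hne : d ≠ 2 ^ L) : 2 * 2 ^ L ≤ d := by
  obtain ⟨c, hc⟩ := (v2_dvd_iff hd L).2 hv
  have hp : 0 < 2 ^ L := by positivity
  rcases c with _ | _ | c
  · omega
  · simp at hc; exact absurd hc hne
  · rw [hc]; nlinarith

theorem dec_f {z w : ℝ} (h1 : z ≤ w) (h2 : w ≤ 1 / 2) : 1 - w + w ^ 2 ≤ 1 - z + z ^ 2 := by
  nlinarith

theorem num1 {x z : ℝ} (h0 : 0 < x) (h1 : x ≤ 1 / 4) (hz0 : 0 < z) (hzx : z ≤ 1 / 4) :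
    1 - z + z ^ 2 ≤ (1 - x * z) * (1 - z ^ 2) := by
  have g1 : x * z ≤ 1 / 4 * z := by nlinarith
  have g2 : z ^ 2 ≤ 1 / 4 * z := by nlinarith
  have g3 : 0 ≤ x * z * z ^ 2 := by positivity
  have : (1 - x * z) * (1 - z ^ 2) = 1 - x * z - z ^ 2 + x * z * z ^ 2 := by ring
  linarith

theorem num2 {x p b : ℝ} (h0 : 0 < x) (h1 : x ≤ 1 / 4) (hp : 0 < p) (hb : b ≤ p * x) (hb0 : 0 ≤ b) :
    1 - p ≤ (1 - b) * (1 - p * x) := by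
  have g1 : p * x ≤ p * (1 / 4) := by nlinarith
  have g3 : 0 ≤ b * (p * x) := by positivity
  have : (1 - b) * (1 - p * x) = 1 - b - p * x + b * (p * x) := by ring
  linarith

theorem real_even {x : ℝ} (h0 : 0 < x) (h1 : x ≤ 1 / 4) (m : ℕ) (hm : Even m) (hm4 : 4 ≤ m)
    (A D : Finset ℕ)
    (hA : ∀ a ∈ A, 0 < a) (hD : ∀ d ∈ D, 0 < d) (hinj : Set.InjOn v2 (D : Set ℕ))
    (hva : ∀ a ∈ A, ∀ d ∈ D, v2 a ≤ v2 d) (hsum : ∑ a ∈ A, a + ∑ d ∈ D, d = m)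
    (hcard : A.card ≤ 1) (L : ℕ) (hL : 1 ≤ L) (hL1 : 3 * 2 ^ (L - 1) ≤ m) (hL2 : m < 3 * 2 ^ L) :
    ((∏ a ∈ A, (1 - x ^ a)) * ∏ d ∈ D, (1 + x ^ d)) * (1 - x) ≤
      (1 - x ^ (m - 2 ^ L + 1)) * (1 - x ^ 2 ^ L) ∧
    1 - x ≤ (1 - x ^ (m - 2 ^ L + 1)) * (1 - x ^ 2 ^ L) := by
  have h2 : x ≤ 1 / 2 := by linarith
  have hx1 : x ≤ 1 := by linarith
  have hpL : 2 ^ L = 2 * 2 ^ (L - 1) := by rw [← pow_succ']; congr 1; omega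
  have hp1 : 0 < 2 ^ (L - 1) := by positivity
  set a0 := m - 2 ^ L + 1 with ha0
  have ha01 : 2 ^ (L - 1) + 1 ≤ a0 := by omega
  have ha03 : 3 ≤ a0 := by
    rcases Nat.eq_or_lt_of_le hL with h | h
    · subst h; simp at ha0; omega
    · have : 2 ^ 1 ≤ 2 ^ (L - 1) := Nat.pow_le_pow_right two_pos (by omega)
      omega
  have e1 : x ^ a0 ≤ x ^ 3 := pow_le_pow_of_le_one h0.le hx1 ha03
  have e2 : x ^ 2 ^ L ≤ x ^ 2 := pow_le_pow_of_le_one h0.le hx1 (by omega)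
  have e3 : x ^ 3 ≤ 1 := pow_le_one₀ h0.le hx1
  have e4 : x ^ 2 ≤ 1 := pow_le_one₀ h0.le hx1
  have hlow : (1 - x ^ 3) * (1 - x ^ 2) ≤ (1 - x ^ a0) * (1 - x ^ 2 ^ L) :=
    mul_le_mul (by linarith) (by linarith) (by linarith) (by linarith)
  have hx2 : x ^ 2 ≤ 1 / 4 * x := by nlinarith
  have hx3 : x ^ 3 ≤ 1 / 16 * x := by nlinarith
  have hpos23 : 0 < x ^ 2 * x ^ 3 := by positivity
  have hge : 1 ≤ (1 + x) * ((1 - x ^ 3) * (1 - x ^ 2)) := by nlinarith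
  refine ⟨?_, ?_⟩
  swap
  · refine le_trans ?_ hlow
    nlinarith
  by_cases hodd : ∃ d ∈ D, v2 d = 0
  swap
  · push Not at hodd
    have hP := lemma_P h0 h2 1 D hD hinj (fun d hd => by have := hodd d hd; omega)
    rw [pow_one] at hP
    have hA1 := prodA_le_one h0 h2 A
    have hpos : 0 ≤ ∏ d ∈ D, (1 + x ^ d) := Finset.prod_nonneg fun d _ => by positivity
    have h5 : (∏ a ∈ A, (1 - x ^ a)) * ∏ d ∈ D, (1 + x ^ d) ≤ ∏ d ∈ D, (1 + x ^ d) :=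
      mul_le_of_le_one_left hpos hA1
    refine le_trans (mul_le_mul_of_nonneg_right h5 (by linarith)) (le_trans ?_ hlow)
    refine le_of_mul_le_mul_right (a := 1 + x) ?_ (by linarith)
    calc _ = (∏ d ∈ D, (1 + x ^ d)) * (1 - x ^ 2) := by ring
      _ ≤ 1 := hP
      _ ≤ _ := by linarith
  · obtain ⟨d, hd, hd0⟩ := hodd
    have hso := sum_odd D hD hinj hd hd0
    have hc : A.card = 1 := by
      by_contra hcon
      have : A.card = 0 := by omega
      rw [Finset.card_eq_zero] at this
      subst this
      simp only [Finset.sum_empty, zero_add] at hsum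
      rw [hsum] at hso
      exact Nat.not_odd_iff_even.2 hm hso
    obtain ⟨a, rfl⟩ := Finset.card_eq_one.1 hc
    simp only [Finset.mem_singleton, forall_eq] at hA hva
    rw [Finset.sum_singleton] at hsum
    rw [Finset.prod_singleton]
    have hao : Odd a := odd_of_v2 hA (by have := hva d hd; omega)
    obtain ⟨t, D', hsub, ht1, ht2, ht3, ht4, ht5⟩ := decomp D hD hinj
    have hQ := lemma_Q h0 h2 D D' hD hinj t hsub ht2 ht3 ht5
    have hxa : 0 < x ^ a := by positivity
    have hxa1 : x ^ a ≤ 1 := pow_le_one₀ h0.le hx1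
    have hDpos : 0 ≤ (∏ d ∈ D, (1 + x ^ d)) * (1 - x) :=
      mul_nonneg (Finset.prod_nonneg fun d _ => by positivity) (by linarith)
    rw [mul_assoc]
    rcases lt_trichotomy t L with htL | htL | htL
    · refine le_trans (mul_le_of_le_one_left hDpos (by linarith)) (hQ.trans ?_)
      set z := x ^ 2 ^ (L - 1) with hz
      have hz0 : 0 < z := by positivity
      have hzx : z ≤ 1 / 4 := by
        calc z ≤ x ^ 1 := pow_le_pow_of_le_one h0.le hx1 hp1
          _ ≤ 1 / 4 := by simpa using h1
      have hzw : z ≤ x ^ 2 ^ t :=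
        pow_le_pow_of_le_one h0.le hx1 (Nat.pow_le_pow_right two_pos (by omega))
      have hw1 : x ^ 2 ^ t ≤ 1 / 2 := pow_le_half h0 h2 (by positivity)
      set w := x ^ 2 ^ t
      have hW : x ^ 2 ^ L = z ^ 2 := by rw [hz, ← pow_mul, hpL, mul_comm]
      have ha : x ^ a0 ≤ x * z := by
        calc x ^ a0 ≤ x ^ (2 ^ (L - 1) + 1) := pow_le_pow_of_le_one h0.le hx1 ha01
          _ = x * z := by rw [pow_succ, hz]; ring
      rw [hW]
      have f1 : 1 - w + w ^ 2 ≤ 1 - z + z ^ 2 := dec_f hzw hw1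
      have f2 : (1 - x * z) * (1 - z ^ 2) ≤ (1 - x ^ a0) * (1 - z ^ 2) :=
        mul_le_mul_of_nonneg_right (by linarith) (by rw [← hW]; linarith)
      refine f1.trans (le_trans ?_ f2)
      exact num1 h0 h1 hz0 hzx
    · subst htL
      have hempty : D' = ∅ := by
        by_contra hne
        obtain ⟨e, he⟩ := Finset.nonempty_iff_ne_empty.2 hne
        have h3 := ge_two_mul (hD e (hsub he)) (ht2 e he) (fun h => ht3 (h ▸ he))
        have h4 := Finset.single_le_sum (f := fun d => d) (fun _ _ => Nat.zero_le _) he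
        omega
      subst hempty
      simp only [Finset.sum_empty, Finset.prod_empty, add_zero, mul_one] at ht4 ht5
      rw [ht5, telescope_real]
      have : a = a0 := by omega
      rw [this]
    · have h3 : 2 ^ (L + 1) ≤ 2 ^ t := Nat.pow_le_pow_right two_pos htL
      rw [pow_succ] at h3
      have ha1 : a ≤ 2 ^ L - 1 := by
        obtain ⟨r, hr⟩ := hao
        omega
      have ha2 : 2 ^ L + 1 ≤ a0 := by omega
      have hP := lemma_P h0 h2 0 D hD hinj (fun _ _ => Nat.zero_le _)
      simp only [pow_zero, pow_one] at hP
      have e5 : x ^ (2 ^ L - 1) ≤ x ^ a := pow_le_pow_of_le_one h0.le hx1 ha1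
      have e6 : x ^ 2 ^ L = x ^ (2 ^ L - 1) * x := by rw [← pow_succ]; congr 1; omega
      have e7 : x ^ a0 ≤ x ^ 2 ^ L := pow_le_pow_of_le_one h0.le hx1 (by omega)
      have e8 : 0 < x ^ (2 ^ L - 1) := by positivity
      have e9 : 0 < x ^ a0 * x ^ 2 ^ L := by positivity
      calc (1 - x ^ a) * ((∏ d ∈ D, (1 + x ^ d)) * (1 - x)) ≤ 1 - x ^ a :=
            mul_le_of_le_one_right (by linarith) hP
        _ ≤ 1 - x ^ (2 ^ L - 1) := by linarith
        _ ≤ _ := by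
          rw [e6] at e7 ⊢
          exact num2 h0 h1 e8 e7 (by positivity)

theorem upper_ge4 {q m o : ℕ} (hq : 4 ≤ q) (hm : 1 ≤ m) {k : ℕ} {A D : Finset ℕ}
    (hA : ∀ a ∈ A, 0 < a)
    (hD : ∀ d ∈ D, 0 < d) (hs : ucost k + ∑ a ∈ A, a + ∑ d ∈ D, d ≤ m)
    (hN : ∀ N, 0 < N → (∀ a ∈ A, q ^ a - 1 ∣ N) → (∀ d ∈ D, q ^ d + 1 ∣ N) → o ≤ 2 ^ k * N) :
    o ≤ Mm m q := by
  have hq0 : (0 : ℝ) < q := by positivity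
  have hq4 : (4 : ℝ) ≤ q := by exact_mod_cast hq
  set x : ℝ := (q : ℝ)⁻¹ with hx
  have h0 : 0 < x := by positivity
  have h1 : x ≤ 1 / 4 := by rw [hx, inv_eq_one_div]; exact one_div_le_one_div_of_le (by norm_num) hq4
  have hqx : (q : ℝ) * x = 1 := mul_inv_cancel₀ hq0.ne'
  have hqxn : ∀ n, (q : ℝ) ^ n * x ^ n = 1 := fun n => by rw [← mul_pow, hqx, one_pow]
  have hred := reduce (Or.inr hq) hA hD hs hN
  -- it suffices to bound in the reals
  suffices H : ∃ μ : ℝ, (Mm m q : ℝ) = (q : ℝ) ^ m * μ ∧ 1 ≤ μ ∧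
      (Set.InjOn v2 (D : Set ℕ) → (∀ a ∈ A, ∀ d ∈ D, v2 a ≤ v2 d) → ∑ a ∈ A, a + ∑ d ∈ D, d = m →
        A.card ≤ 1 → (∏ a ∈ A, (1 - x ^ a)) * ∏ d ∈ D, (1 + x ^ d) ≤ μ) by
    obtain ⟨μ, hμ, hμ1, hV⟩ := H
    have hqm : (0 : ℝ) < (q : ℝ) ^ m := by positivity
    rcases hred with h | ⟨c1, c2, c3, c4, c5, c6⟩
    · refine h.trans ?_
      have : ((q ^ m : ℕ) : ℝ) ≤ (Mm m q : ℝ) := by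
        rw [hμ]; push_cast; exact le_mul_of_one_le_right hqm.le hμ1
      exact_mod_cast this
    · obtain ⟨hk0, hcard⟩ := c5 hq
      subst hk0
      rw [zero_add] at c3
      rw [pow_zero, one_mul] at c6
      refine c6.trans ?_
      have h3 := cast_pairprod (show 1 ≤ q by omega) A D
      rw [c3] at h3
      have : (((∏ a ∈ A, (q ^ a - 1)) * ∏ d ∈ D, (q ^ d + 1) : ℕ) : ℝ) ≤ (Mm m q : ℝ) := by
        rw [h3, hμ]
        exact mul_le_mul_of_nonneg_left (hV c1 c2 c3 hcard) hqm.le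
      exact_mod_cast this
  rcases Nat.even_or_odd m with hme | hmo
  · by_cases hm2 : m = 2
    · subst hm2
      have : Mm 2 q = q ^ 2 + 1 := by
        rw [Mm, if_neg (by omega), if_neg (by decide), if_pos rfl]
      refine ⟨1 + x ^ 2, ?_, by nlinarith, fun c1 c2 c3 c4 => real_m2 h0 h1 A D hA hD c1 c3 c4⟩
      rw [this, mul_add, hqxn]; push_cast; ring
    · have hm4 : 4 ≤ m := by obtain ⟨r, hr⟩ := hme; omega
      obtain ⟨L, hL, hL1, hL2, h3⟩ := Mm_even_spec m q (by omega) hme hm4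
      have hx1 : 0 < 1 - x := by linarith
      have hpL : 2 ^ L = 2 * 2 ^ (L - 1) := by rw [← pow_succ']; congr 1; omega
      refine ⟨(1 - x ^ (m - 2 ^ L + 1)) * (1 - x ^ 2 ^ L) / (1 - x), ?_, ?_, ?_⟩
      · have hq1 : 0 < q - 1 := by omega
        have e1 : Mm m q * (q - 1) = (q ^ (m - 2 ^ L + 1) - 1) * (q ^ 2 ^ L - 1) := by
          rw [h3]
          refine Nat.div_mul_cancel (Dvd.dvd.mul_left ?_ _)
          simpa using Nat.pow_sub_one_dvd_pow_sub_one q (one_dvd (2 ^ L))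
        have e2 : (Mm m q : ℝ) * (q - 1) =
            ((q : ℝ) ^ (m - 2 ^ L + 1) - 1) * ((q : ℝ) ^ 2 ^ L - 1) := by
          have := congrArg (fun n : ℕ => (n : ℝ)) e1
          simp only [Nat.cast_mul] at this
          rw [Nat.cast_sub (by omega), Nat.cast_sub (Nat.one_le_pow _ _ (by omega)),
            Nat.cast_sub (Nat.one_le_pow _ _ (by omega))] at this
          push_cast at this
          exact this
        rw [← mul_div_assoc, eq_div_iff hx1.ne']
        have e3 : (Mm m q : ℝ) * (1 - x) * q = (Mm m q : ℝ) * (q - 1) := by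
          linear_combination (-(Mm m q : ℝ)) * hqx
        refine mul_right_cancel₀ hq0.ne' ?_
        rw [e3, e2]
        have e4 : (q : ℝ) ^ m * q = (q : ℝ) ^ (m - 2 ^ L + 1) * (q : ℝ) ^ 2 ^ L := by
          rw [← pow_succ, ← pow_add]; congr 1; omega
        calc _ = ((q : ℝ) ^ (m - 2 ^ L + 1) * (1 - x ^ (m - 2 ^ L + 1))) *
              ((q : ℝ) ^ 2 ^ L * (1 - x ^ 2 ^ L)) := by
              rw [mul_sub _ _ (x ^ (m - 2 ^ L + 1)), mul_sub _ _ (x ^ 2 ^ L), hqxn, hqxn, mul_one, mul_one]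
          _ = ((q : ℝ) ^ (m - 2 ^ L + 1) * (q : ℝ) ^ 2 ^ L) *
              ((1 - x ^ (m - 2 ^ L + 1)) * (1 - x ^ 2 ^ L)) := by ring
          _ = _ := by rw [← e4]; ring
      · rw [le_div_iff₀ hx1, one_mul]
        exact (real_even h0 h1 m hme hm4 ∅ {m} (by simp) (by simp; omega) (by simp) (by simp)
          (by simp) (by simp) L hL hL1 hL2).2
      · intro c1 c2 c3 c4
        rw [le_div_iff₀ hx1]
        exact (real_even h0 h1 m hme hm4 A D hA hD c1 c2 c3 c4 L hL hL1 hL2).1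
  · obtain ⟨E, hE1, hE2⟩ := Mm_odd_spec m q (by omega) hmo
    refine ⟨∏ i ∈ E, (1 + x ^ 2 ^ i), ?_, ?_, fun c1 c2 c3 c4 =>
      real_odd h0 h1 m hmo A D hA hD c1 c2 c3 c4 E hE1⟩
    · rw [hE2]
      conv_rhs => rw [← hE1]
      rw [← Finset.prod_pow_eq_pow_sum, ← Finset.prod_mul_distrib]
      push_cast
      refine Finset.prod_congr rfl fun i _ => ?_
      rw [mul_add, hqxn]; ring
    · refine one_le_prod_real _ _ fun i _ => ?_
      have : 0 < x ^ 2 ^ i := by positivity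
      linarith


theorem num3 {v : ℝ} (h0 : 0 < v) (h1 : v ≤ 1 / 4) : 1 - v + v ^ 2 ≤ 1 - 2 * v ^ 2 := by nlinarith

theorem num4 {b c y : ℝ} (hb : b ≤ y) (hc : c ≤ y) (hb0 : 0 ≤ b) (hc0 : 0 ≤ c) :
    1 - 2 * y ≤ (1 - b) * (1 - c) := by
  have g3 : 0 ≤ b * c := by positivity
  have : (1 - b) * (1 - c) = 1 - b - c + b * c := by ring
  linarith

theorem num5 {b y : ℝ} (hy0 : 0 < y) (hy : y ≤ 1 / 16) (hb : b ≤ y / 2) :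
    (1 - y) * (1 + y ^ 2) ≤ (1 - b) * (1 - y ^ 2) ∧ 1 - y ≤ (1 - y) * (1 + y ^ 2) := by
  have g1 : y ^ 2 ≤ 1 / 16 * y := by nlinarith
  have g2 : (1 - y / 2) * (1 - y ^ 2) ≤ (1 - b) * (1 - y ^ 2) :=
    mul_le_mul_of_nonneg_right (by linarith) (by linarith)
  have g3 : 0 < y ^ 3 := by positivity
  have e1 : (1 - y) * (1 + y ^ 2) = 1 - y + y ^ 2 - y ^ 3 := by ring
  have e2 : (1 - y / 2) * (1 - y ^ 2) = 1 - y / 2 - y ^ 2 + y ^ 3 / 2 := by ring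
  have g4 : y ^ 3 ≤ y ^ 2 := by
    have : y ^ 3 = y ^ 2 * y := by ring
    nlinarith [sq_nonneg y]
  constructor <;> linarith

theorem core_two {x : ℝ} (hx : x = 2⁻¹) (m : ℕ) (k : ℕ) (hk : k ≤ 3) (A D : Finset ℕ)
    (hA : ∀ a ∈ A, 0 < a) (hD : ∀ d ∈ D, 0 < d) (hinj : Set.InjOn v2 (D : Set ℕ))
    (hva : ∀ a ∈ A, ∀ d ∈ D, v2 a ≤ v2 d) (hsum : k + ∑ a ∈ A, a + ∑ d ∈ D, d = m)
    (L : ℕ) (hL1 : 2 ^ L ≤ m + 1) (hL2 : m + 1 < 2 ^ (L + 1))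
    (m0 : ℕ) (hm0 : m0 + 2 ^ L = m + 1) (H : ℝ)
    (hH : H = ((∏ a ∈ A, (1 - x ^ a)) * ∏ d ∈ D, (1 + x ^ d)) * (1 - x)) :
    (m0 ≤ 3 → H ≤ 1 - x ^ 2 ^ L) ∧ (3 < m0 →
      H ≤ 1 - 2 * x ^ 2 ^ (L - 1) ∨
      (∃ a, Odd a ∧ a ≤ m0 ∧ H ≤ (1 - x ^ a) * (1 - (x ^ 2 ^ (L - 1)) ^ 2)) ∨
      (∃ a, Odd a ∧ a ≤ m0 + 2 ^ (L - 1) ∧ H ≤ (1 - x ^ a) * (1 - x ^ 2 ^ (L - 1))) ∨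
      (2 ^ (L - 1) ≤ m0 ∧ H ≤ (1 - x ^ 2 ^ (L - 1)) * (1 + (x ^ 2 ^ (L - 1)) ^ 2))) := by
  have h0 : 0 < x := by rw [hx]; norm_num
  have h2 : x ≤ 1 / 2 := by rw [hx]; norm_num
  have hx1 : x ≤ 1 := by linarith
  have hLs : 2 ^ (L + 1) = 2 * 2 ^ L := pow_succ' 2 L
  obtain ⟨t, D', hsub, ht1, ht2, ht3, ht4, ht5⟩ := decomp D hD hinj
  have hQ := lemma_Q h0 h2 D D' hD hinj t hsub ht2 ht3 ht5
  have hDpos : 0 ≤ (∏ d ∈ D, (1 + x ^ d)) * (1 - x) :=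
    mul_nonneg (Finset.prod_nonneg fun d _ => by positivity) (by linarith)
  have hA1 := prodA_le_one h0 h2 A
  rw [mul_assoc] at hH
  have hHQ : H ≤ 1 - x ^ 2 ^ t + (x ^ 2 ^ t) ^ 2 := by
    rw [hH]; exact (mul_le_of_le_one_left hDpos hA1).trans hQ
  have htL : t ≤ L := by
    by_contra hcon
    have : 2 ^ (L + 1) ≤ 2 ^ t := Nat.pow_le_pow_right two_pos (by omega)
    omega
  have hw0 : 0 < x ^ 2 ^ t := by positivity
  have hw1 : x ^ 2 ^ t ≤ 1 / 2 := pow_le_half h0 h2 (by positivity)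
  have hsingle : ∀ d ∈ D', d ≤ ∑ d ∈ D', d := fun d hd =>
    Finset.single_le_sum (f := fun d => d) (fun _ _ => Nat.zero_le _) hd
  -- the case t = L
  have hTL : t = L → ∑ d ∈ D, d = 2 ^ L - 1 ∧ H = (∏ a ∈ A, (1 - x ^ a)) * (1 - x ^ 2 ^ L) := by
    rintro rfl
    have hempty : D' = ∅ := by
      by_contra hne
      obtain ⟨e, he⟩ := Finset.nonempty_iff_ne_empty.2 hne
      have h3 := ge_two_mul (hD e (hsub he)) (ht2 e he) (fun h => ht3 (h ▸ he))
      have h4 := hsingle e he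
      omega
    subst hempty
    simp only [Finset.sum_empty, Finset.prod_empty, add_zero, mul_one] at ht4 ht5
    refine ⟨ht4, ?_⟩
    rw [hH, ht5, telescope_real]
  refine ⟨fun _ => ?_, fun hm3 => ?_⟩
  · rcases Nat.lt_or_eq_of_le htL with h | h
    · refine hHQ.trans ?_
      have h3 : x ^ 2 ^ L ≤ (x ^ 2 ^ t) ^ 2 := by
        rw [← pow_mul, ← pow_succ]
        exact pow_le_pow_of_le_one h0.le hx1 (Nat.pow_le_pow_right two_pos h)
      nlinarith
    · rw [(hTL h).2]
      have : x ^ 2 ^ L ≤ 1 := pow_le_one₀ h0.le hx1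
      exact mul_le_of_le_one_left (by linarith) hA1
  have hL3 : 3 ≤ L := by
    by_contra hcon
    have : 2 ^ L ≤ 2 ^ 2 := Nat.pow_le_pow_right two_pos (by omega)
    omega
  have hpL : 2 ^ L = 2 * 2 ^ (L - 1) := by rw [← pow_succ']; congr 1; omega
  have hpL' : 2 ^ (L - 1) = 2 * 2 ^ (L - 2) := by rw [← pow_succ']; congr 1; omega
  have hp4 : 2 ≤ 2 ^ (L - 2) := by
    simpa using Nat.pow_le_pow_right two_pos (show 1 ≤ L - 2 by omega)
  have hyy : x ^ 2 ^ L = (x ^ 2 ^ (L - 1)) ^ 2 := by rw [← pow_mul, hpL, mul_comm]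
  have hyv : x ^ 2 ^ (L - 1) = (x ^ 2 ^ (L - 2)) ^ 2 := by rw [← pow_mul, hpL', mul_comm]
  have hoddA : 1 ≤ t → ∀ a ∈ A, Odd a := by
    intro ht a ha
    have h1D : 2 ^ 0 ∈ D := ht1 0 (by omega)
    have h3 := hva a ha _ h1D
    rw [v2_two_pow] at h3
    exact odd_of_v2 (hA a ha) (by omega)
  have hsA : ∀ a ∈ A, a ≤ ∑ a ∈ A, a := fun d hd =>
    Finset.single_le_sum (f := fun d => d) (fun _ _ => Nat.zero_le _) hd
  have hy0 : 0 < x ^ 2 ^ (L - 1) := by positivity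
  have hy1 : x ^ 2 ^ (L - 1) ≤ 1 / 2 := pow_le_half h0 h2 (by positivity)
  rcases Nat.lt_or_eq_of_le htL with h | h
  · rcases Nat.lt_or_eq_of_le (show t ≤ L - 1 by omega) with h' | h'
    · left
      have hv : x ^ 2 ^ (L - 2) ≤ x ^ 2 ^ t :=
        pow_le_pow_of_le_one h0.le hx1 (Nat.pow_le_pow_right two_pos (by omega))
      have hv0 : 0 < x ^ 2 ^ (L - 2) := by positivity
      have hv1 : x ^ 2 ^ (L - 2) ≤ 1 / 4 := by
        calc x ^ 2 ^ (L - 2) ≤ x ^ 2 := pow_le_pow_of_le_one h0.le hx1 hp4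
          _ = 1 / 4 := by rw [hx]; norm_num
      rw [hyv]
      exact hHQ.trans ((dec_f hv hw1).trans (num3 hv0 hv1))
    · subst h'
      right; right
      by_cases hempty : D' = ∅
      · left
        subst hempty
        simp only [Finset.sum_empty, Finset.prod_empty, add_zero, mul_one] at ht4 ht5
        have hne : A.Nonempty := by
          by_contra hcon
          rw [Finset.not_nonempty_iff_eq_empty] at hcon
          rw [hcon, Finset.sum_empty] at hsum
          omega
        obtain ⟨a, ha⟩ := hne
        refine ⟨a, hoddA (by omega) a ha, ?_, ?_⟩
        · have := hsA a ha; omega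
        · rw [hH, ht5, telescope_real]
          exact mul_le_mul_of_nonneg_right (prodA_le h0 h2 A ha) (by linarith)
      · right
        obtain ⟨e, he⟩ := Finset.nonempty_iff_ne_empty.2 hempty
        have hge : ∀ d ∈ D', 2 ^ L ≤ d := fun d hd => by
          have := ge_two_mul (hD d (hsub hd)) (ht2 d hd) (fun h => ht3 (h ▸ hd))
          omega
        have hone : D' = {e} := by
          refine Finset.eq_singleton_iff_unique_mem.2 ⟨he, fun d hd => ?_⟩
          by_contra hne
          have h3 : ∑ i ∈ ({d, e} : Finset ℕ), i ≤ ∑ d ∈ D', d :=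
            Finset.sum_le_sum_of_subset (by
              intro i hi; simp at hi; rcases hi with rfl | rfl <;> assumption)
          rw [Finset.sum_pair hne] at h3
          have := hge d hd
          have := hge e he
          omega
        have he2 : 2 ^ L ≤ e := hge e he
        rw [hone] at ht4 ht5
        simp only [Finset.sum_singleton, Finset.prod_singleton] at ht4 ht5
        refine ⟨by omega, ?_⟩
        rw [hH, ht5, mul_right_comm, telescope_real]
        have h3 : x ^ e ≤ (x ^ 2 ^ (L - 1)) ^ 2 := by
          rw [← hyy]; exact pow_le_pow_of_le_one h0.le hx1 he2
        have h4 : 0 < x ^ e := by positivity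
        refine (mul_le_of_le_one_left (mul_nonneg (by linarith) (by linarith)) hA1).trans ?_
        exact mul_le_mul_of_nonneg_left (by linarith) (by linarith)
  · right; left
    obtain ⟨k1, k2⟩ := hTL h
    have hne : A.Nonempty := by
      by_contra hcon
      rw [Finset.not_nonempty_iff_eq_empty] at hcon
      rw [hcon, Finset.sum_empty] at hsum
      omega
    obtain ⟨a, ha⟩ := hne
    refine ⟨a, hoddA (by omega) a ha, ?_, ?_⟩
    · have := hsA a ha; omega
    · rw [k2, ← hyy]
      have : x ^ 2 ^ L ≤ 1 := pow_le_one₀ h0.le hx1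
      exact mul_le_mul_of_nonneg_right (prodA_le h0 h2 A ha) (by linarith)

theorem cast_pow_sub (n : ℕ) : ((2 ^ n - 1 : ℕ) : ℝ) = 2 ^ n * (1 - (2⁻¹ : ℝ) ^ n) := by
  rw [Nat.cast_sub Nat.one_le_two_pow, mul_sub, ← mul_pow, mul_inv_cancel₀ (by norm_num)]
  simp

theorem cast_pow_add (n : ℕ) : ((2 ^ n + 1 : ℕ) : ℝ) = 2 ^ n * (1 + (2⁻¹ : ℝ) ^ n) := by
  rw [mul_add, ← mul_pow, mul_inv_cancel₀ (by norm_num)]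
  simp

theorem upper_two {m o : ℕ} (hm : 1 ≤ m) {k : ℕ} {A D : Finset ℕ}
    (hA : ∀ a ∈ A, 0 < a)
    (hD : ∀ d ∈ D, 0 < d) (hs : ucost k + ∑ a ∈ A, a + ∑ d ∈ D, d ≤ m)
    (hN : ∀ N, 0 < N → (∀ a ∈ A, 2 ^ a - 1 ∣ N) → (∀ d ∈ D, 2 ^ d + 1 ∣ N) → o ≤ 2 ^ k * N) :
    o ≤ Mm m 2 := by
  obtain ⟨x, hx⟩ : ∃ x : ℝ, x = 2⁻¹ := ⟨_, rfl⟩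
  have h0 : 0 < x := by rw [hx]; norm_num
  have h2 : x ≤ 1 / 2 := by rw [hx]; norm_num
  have hx1 : x ≤ 1 := by linarith
  have hred := reduce (Or.inl rfl) hA hD hs hN
  obtain ⟨L, hL, hL1, hL2, hM⟩ := Mm_two_spec m hm
  dsimp only at hM
  obtain ⟨m0, hm0⟩ : ∃ m0, m0 = m - (2 ^ L - 1) := ⟨_, rfl⟩
  rw [← hm0] at hM
  have hpos : 0 < 2 ^ L := by positivity
  have hm0' : m0 + 2 ^ L = m + 1 := by omega
  suffices H : ∃ η : ℝ, (Mm m 2 : ℝ) = 2 ^ (m + 1) * η ∧ 1 / 2 ≤ η ∧ ∀ H : ℝ,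
      ((m0 ≤ 3 → H ≤ 1 - x ^ 2 ^ L) ∧ (3 < m0 →
      H ≤ 1 - 2 * x ^ 2 ^ (L - 1) ∨
      (∃ a, Odd a ∧ a ≤ m0 ∧ H ≤ (1 - x ^ a) * (1 - (x ^ 2 ^ (L - 1)) ^ 2)) ∨
      (∃ a, Odd a ∧ a ≤ m0 + 2 ^ (L - 1) ∧ H ≤ (1 - x ^ a) * (1 - x ^ 2 ^ (L - 1))) ∨
      (2 ^ (L - 1) ≤ m0 ∧ H ≤ (1 - x ^ 2 ^ (L - 1)) * (1 + (x ^ 2 ^ (L - 1)) ^ 2)))) → H ≤ η by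
    obtain ⟨η, hη, hη1, hV⟩ := H
    rcases hred with h | ⟨c1, c2, c3, c4, -, c6⟩
    · refine h.trans ?_
      have : ((2 ^ m : ℕ) : ℝ) ≤ (Mm m 2 : ℝ) := by
        rw [hη, pow_succ]; push_cast
        have : (0 : ℝ) < 2 ^ m := by positivity
        nlinarith
      exact_mod_cast this
    · have hc := core_two hx m k c4 A D hA hD c1 c2 c3 L hL1 hL2 m0 hm0' _ rfl
      have hV' := hV _ hc
      refine c6.trans ?_
      have h3 := cast_pairprod (show 1 ≤ 2 by omega) A D
      push_cast at h3
      rw [← hx] at h3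
      have : ((2 ^ k * ((∏ a ∈ A, (2 ^ a - 1)) * ∏ d ∈ D, (2 ^ d + 1)) : ℕ) : ℝ) ≤ (Mm m 2 : ℝ) := by
        push_cast
        rw [h3, hη, ← mul_assoc, ← pow_add, ← add_assoc, c3, pow_succ, mul_assoc]
        refine mul_le_mul_of_nonneg_left ?_ (by positivity)
        rw [hx] at hV' ⊢
        linarith
      exact_mod_cast this
  have hWL : x ^ 2 ^ L ≤ 1 / 2 := pow_le_half h0 h2 (by positivity)
  by_cases c1 : m0 ≤ 3
  · rw [if_pos c1] at hM
    refine ⟨1 - x ^ 2 ^ L, ?_, by linarith, fun H hH => hH.1 c1⟩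
    rw [hM, Nat.cast_mul, cast_pow_sub, ← hx, ← mul_assoc, ← hm0', pow_add]
    push_cast; ring
  rw [if_neg c1] at hM
  have c1' : 3 < m0 := by omega
  have hL3 : 3 ≤ L := by
    by_contra hcon
    have h3 : 2 ^ L ≤ 2 ^ 2 := Nat.pow_le_pow_right two_pos (by omega)
    rw [pow_succ] at hL2
    omega
  have hpL : 2 ^ L = 2 * 2 ^ (L - 1) := by rw [← pow_succ']; congr 1; omega
  have hpL' : 2 ^ (L - 1) = 2 * 2 ^ (L - 2) := by rw [← pow_succ']; congr 1; omega
  have hp4 : 2 ≤ 2 ^ (L - 2) := by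
    simpa using Nat.pow_le_pow_right two_pos (show 1 ≤ L - 2 by omega)
  have hyy : x ^ 2 ^ L = (x ^ 2 ^ (L - 1)) ^ 2 := by rw [← pow_mul, hpL, mul_comm]
  have hmono : ∀ {a b : ℕ}, a ≤ b → x ^ b ≤ x ^ a := fun h => pow_le_pow_of_le_one h0.le hx1 h
  have h2y : x ^ (2 ^ (L - 1) - 1) = 2 * x ^ 2 ^ (L - 1) := by
    have : x ^ 2 ^ (L - 1) = x ^ (2 ^ (L - 1) - 1) * x := by rw [← pow_succ]; congr 1; omega
    rw [this, hx]; ring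
  have hhalf : x ^ (2 ^ (L - 1) + 1) = x ^ 2 ^ (L - 1) / 2 := by
    rw [pow_succ]; rw [hx]; ring
  have hy16 : x ^ 2 ^ (L - 1) ≤ 1 / 16 := by
    calc x ^ 2 ^ (L - 1) ≤ x ^ 4 := hmono (by omega)
      _ = 1 / 16 := by rw [hx]; norm_num
  have hy0 : 0 < x ^ 2 ^ (L - 1) := by positivity
  have hxp : ∀ a, 0 ≤ x ^ a := fun a => by positivity
  -- o2 bound when a small
  have hsmall : ∀ {a : ℕ} {H : ℝ}, a ≤ 2 ^ (L - 1) - 1 →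
      H ≤ (1 - x ^ a) * (1 - (x ^ 2 ^ (L - 1)) ^ 2) → H ≤ 1 - 2 * x ^ 2 ^ (L - 1) := by
    intro a H ha hH
    refine hH.trans ?_
    have h3 := hmono ha
    have h4 : x ^ a ≤ 1 := pow_le_one₀ h0.le hx1
    have h5 : (1 - x ^ a) * (1 - (x ^ 2 ^ (L - 1)) ^ 2) ≤ 1 - x ^ a :=
      mul_le_of_le_one_right (by linarith) (by linarith [sq_nonneg (x ^ 2 ^ (L - 1))])
    linarith
  by_cases c2 : m0 < 2 ^ (L - 1)
  · rw [if_pos c2] at hM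
    obtain ⟨r, hr1, hr2, hr3, hr4⟩ : ∃ r, 2 ^ (L - 1) ≤ r ∧
        (Mm m 2 : ℝ) = 2 ^ (m + 1) * ((1 - x ^ r) * (1 - x ^ 2 ^ (L - 1))) ∧
        (∀ a, Odd a → a ≤ m0 + 2 ^ (L - 1) → a ≤ r) ∧ True := by
      by_cases c3 : Odd m0
      · rw [if_pos c3] at hM
        refine ⟨2 ^ (L - 1) + m0, by omega, ?_, fun a _ _ => by omega, trivial⟩
        rw [hM, Nat.cast_mul, cast_pow_sub, cast_pow_sub, ← hx,
          show m + 1 = (2 ^ (L - 1) + m0) + 2 ^ (L - 1) by omega, pow_add 2 (2 ^ (L - 1) + m0)]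
        ring
      · rw [if_neg c3] at hM
        obtain ⟨s, hs'⟩ := Nat.not_odd_iff_even.1 c3
        refine ⟨2 ^ (L - 1) + m0 - 1, by omega, ?_, fun a ⟨b, hb⟩ _ => by omega, trivial⟩
        rw [hM, Nat.cast_mul, Nat.cast_mul, cast_pow_sub, cast_pow_sub, ← hx,
          show m + 1 = 1 + ((2 ^ (L - 1) + m0 - 1) + 2 ^ (L - 1)) by omega, pow_add 2 1,
          pow_add 2 (2 ^ (L - 1) + m0 - 1)]
        push_cast
        ring
    have hη : 1 - 2 * x ^ 2 ^ (L - 1) ≤ (1 - x ^ r) * (1 - x ^ 2 ^ (L - 1)) :=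
      num4 (hmono hr1) le_rfl (hxp _) (hxp _)
    refine ⟨_, hr2, by linarith, fun H hH => ?_⟩
    rcases hH.2 c1' with o | ⟨a, oa, ob, o⟩ | ⟨a, oa, ob, o⟩ | ⟨ob, o⟩
    · exact o.trans hη
    · exact (hsmall (by omega) o).trans hη
    · refine o.trans (mul_le_mul_of_nonneg_right ?_ (by linarith))
      have := hmono (hr3 a oa ob); linarith
    · omega
  rw [if_neg c2] at hM
  by_cases c4 : m0 = 2 ^ (L - 1)
  · rw [if_pos c4] at hM
    obtain ⟨-, h5⟩ := num5 (b := 0) hy0 hy16 (by linarith)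
    refine ⟨(1 - x ^ 2 ^ (L - 1)) * (1 + (x ^ 2 ^ (L - 1)) ^ 2), ?_, by linarith, fun H hH => ?_⟩
    · rw [hM, Nat.cast_mul, cast_pow_sub, cast_pow_add, ← hx, ← hyy,
        show m + 1 = 2 ^ L + 2 ^ (L - 1) by omega, pow_add]
      ring
    rcases hH.2 c1' with o | ⟨a, oa, ob, o⟩ | ⟨a, oa, ob, o⟩ | ⟨ob, o⟩
    · linarith
    · have := hsmall (by obtain ⟨b, hb⟩ := oa; omega) o
      linarith
    · refine o.trans (le_trans ?_ h5)
      exact mul_le_of_le_one_left (by linarith) (by linarith [hxp a])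
    · exact o
  · rw [if_neg c4] at hM
    obtain ⟨r, hr1, hr2, hr3, hr4⟩ : ∃ r, 2 ^ (L - 1) + 1 ≤ r ∧
        (Mm m 2 : ℝ) = 2 ^ (m + 1) * ((1 - x ^ r) * (1 - (x ^ 2 ^ (L - 1)) ^ 2)) ∧
        (∀ a, Odd a → a ≤ m0 → a ≤ r) ∧ True := by
      by_cases c3 : Odd m0
      · rw [if_pos c3] at hM
        refine ⟨m0, by omega, ?_, fun a _ _ => by omega, trivial⟩
        rw [hM, Nat.cast_mul, cast_pow_sub, cast_pow_sub, ← hx, ← hyy,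
          show m + 1 = m0 + 2 ^ L by omega, pow_add]
        ring
      · rw [if_neg c3] at hM
        obtain ⟨s, hs'⟩ := Nat.not_odd_iff_even.1 c3
        refine ⟨m0 - 1, by omega, ?_, fun a ⟨b, hb⟩ _ => by omega, trivial⟩
        rw [hM, Nat.cast_mul, Nat.cast_mul, cast_pow_sub, cast_pow_sub, ← hx, ← hyy,
          show m + 1 = 1 + ((m0 - 1) + 2 ^ L) by omega, pow_add 2 1,
          pow_add 2 (m0 - 1)]
        push_cast
        ring
    have hr5 := hmono hr1
    rw [hhalf] at hr5
    obtain ⟨h4, h5⟩ := num5 hy0 hy16 hr5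
    refine ⟨_, hr2, by linarith, fun H hH => ?_⟩
    rcases hH.2 c1' with o | ⟨a, oa, ob, o⟩ | ⟨a, oa, ob, o⟩ | ⟨ob, o⟩
    · linarith
    · refine o.trans (mul_le_mul_of_nonneg_right ?_ (by rw [← hyy]; linarith))
      have := hmono (hr3 a oa ob); linarith
    · refine o.trans (le_trans ?_ (h5.trans h4))
      exact mul_le_of_le_one_left (by linarith) (by linarith [hxp a])
    · exact o.trans h4

/-- The maximum order of an element of the symplectic group Sp_2m(q), q even, is M_m(q). -/
theorem max_order_symplectic (f q m : ℕ) (hf : 1 ≤ f) (hq : q = 2 ^ f) (hm : 1 ≤ m)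
    (F : Type) [Field F] [Fintype F] (hF : Fintype.card F = q) :
    (∃ g : Matrix.symplecticGroup (Fin m) F, orderOf g = Mm m q) ∧
      ∀ g : Matrix.symplecticGroup (Fin m) F, orderOf g ≤ Mm m q := by
  have hchar : CharP F 2 := by
    have h1 : ((2 : ℕ) : F) = 0 := by
      have h2 : ((Fintype.card F : ℕ) : F) = 0 := Nat.cast_card_eq_zero F
      rw [hF, hq, Nat.cast_pow] at h2
      exact eq_zero_of_pow_eq_zero h2
    exact CharTwo.of_one_ne_zero_of_two_eq_zero one_ne_zero (by exact_mod_cast h1)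
  have hq0 : 0 < q := by rw [hq]; positivity
  have hqe : Even q := by rw [hq, Nat.even_pow]; exact ⟨even_two, by omega⟩
  have hcase : q = 2 ∨ 4 ≤ q := by
    rcases Nat.eq_or_lt_of_le hf with h | h
    · left; rw [hq, ← h, pow_one]
    · right; rw [hq]
      exact Nat.pow_le_pow_right two_pos (show 2 ≤ f from h)
  refine ⟨lower_bound (by rw [Nat.card_eq_fintype_card, hF]) hqe hq0 m hm, fun g => ?_⟩
  obtain ⟨k, A, D, hA, hD, hs, hN⟩ := structure_thm q m F hF g
  rcases hcase with h | h
  · subst h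
    exact upper_two hm hA hD hs hN
  · exact upper_ge4 h hm hA hD hs hN
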